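/- Let (Λ_Q, f) be a C^{1+Lip} expansive and transitive Markov system. Then the Hausdorff dimension of Λ_Q equals t_c = inf{t ≥ 0 : there exists a t-conformal measure supported on Λ_Q}. -/

import Mathlib

open Set Metric Filter MeasureTheory
open scoped Classical

/-- The word `[ω 0, ω 1, …, ω (n-1)]` read off from the sequence `ω`. -/
def wordOf {p : ℕ} (ω : ℕ → Fin p) (n : ℕ) : List (Fin p) :=
  (List.range n).map ω

/-- The cylinder sets `Δ_{i₁…iₙ} = g_{i₁…i_{n-1}}(I_{iₙ})` of the iterated function
system given by the big interval `I`, the subintervals `Isub i` and the maps `g i`;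
by convention `Δ_∅ = I`. -/
def cylOf {p : ℕ} (I : Set ℝ) (Isub : Fin p → Set ℝ) (g : Fin p → ℝ → ℝ) :
    List (Fin p) → Set ℝ
  | [] => I
  | [i] => Isub i
  | i :: j :: w => g i '' cylOf I Isub g (j :: w)

/-- The sequence `ω` contains the word `w` as a sub-word starting at position `n`. -/
def containsAt {p : ℕ} (ω : ℕ → Fin p) (w : List (Fin p)) (n : ℕ) : Prop :=
  ∀ k : ℕ, (hk : k < w.length) → ω (n + k) = w.get ⟨k, hk⟩

/-- The sequence `ω` belongs to `Σ_Q`, i.e. it contains no word of `Q` as a sub-word. -/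
def avoids {p : ℕ} (Q : Finset (List (Fin p))) (ω : ℕ → Fin p) : Prop :=
  ∀ w ∈ Q, ∀ n : ℕ, ¬ containsAt ω w n

/-- The limit set `Λ_Q = π(Σ_Q)`: points lying, for some `ω ∈ Σ_Q`, in all the
cylinders `Δ_{ω₀…ω_{n-1}}`. -/
def limitSetOf {p : ℕ} (I : Set ℝ) (Isub : Fin p → Set ℝ) (g : Fin p → ℝ → ℝ)
    (Q : Finset (List (Fin p))) : Set ℝ :=
  { x | ∃ ω : ℕ → Fin p, avoids Q ω ∧ ∀ n : ℕ, x ∈ cylOf I Isub g (wordOf ω n) }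

/-- `gIter g ω n = g_{i_n … i_1} = g_{ω (n-1)} ∘ ⋯ ∘ g_{ω 0}`. -/
def gIter {p : ℕ} (g : Fin p → ℝ → ℝ) (ω : ℕ → Fin p) : ℕ → ℝ → ℝ
  | 0 => id
  | n + 1 => g (ω n) ∘ gIter g ω n

/-- The derivative of the composition `gIter g ω n` at `x` (chain rule product). -/
noncomputable def gIterDer {p : ℕ} (g gder : Fin p → ℝ → ℝ) (ω : ℕ → Fin p)
    (n : ℕ) (x : ℝ) : ℝ :=
  ∏ k ∈ Finset.range n, gder (ω k) (gIter g ω k x)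

/-- Prepending the finite word `w` to the infinite sequence `ω`. -/
def prependWord {p : ℕ} (w : List (Fin p)) (ω : ℕ → Fin p) : ℕ → Fin p :=
  fun n => if h : n < w.length then w.get ⟨n, h⟩ else ω (n - w.length)

/-- `l(Σ_Q)`: the minimum, over all finite sets `Q'` of words with `Σ_{Q'} = Σ_Q`,
of the maximal length `l(Q')` of words of `Q'`. -/
noncomputable def minRepLen {p : ℕ} (Q : Finset (List (Fin p))) : ℕ :=
  sInf { n : ℕ | ∃ Q' : Finset (List (Fin p)),
    (∀ ω : ℕ → Fin p, avoids Q' ω ↔ avoids Q ω) ∧ Q'.sup List.length = n }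

/-- A `C^{1+Lip}` expansive and transitive Markov system `(Λ_Q, f)`. -/
structure ExpansiveMarkovSystem (p : ℕ) where
  /-- the alphabet is nonempty -/
  hp : 0 < p
  /-- the ambient closed interval `I` -/
  I : Set ℝ
  hI : ∃ a b : ℝ, a < b ∧ I = Set.Icc a b
  /-- the pairwise disjoint closed subintervals `I₁, …, I_p` -/
  Isub : Fin p → Set ℝ
  hIsub : ∀ i, ∃ a b : ℝ, a < b ∧ Isub i = Set.Icc a b
  hsubI : ∀ i, Isub i ⊆ I
  hdisj : ∀ i j, i ≠ j → Disjoint (Isub i) (Isub j)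
  /-- the contractions `g i`, defined on `⋃ j, Isub j` -/
  g : Fin p → ℝ → ℝ
  /-- the derivative of `g i` on `⋃ j, Isub j` -/
  gder : Fin p → ℝ → ℝ
  hg_inj : ∀ i, Set.InjOn (g i) (⋃ j, Isub j)
  hg_range : ∀ i, g i '' (⋃ j, Isub j) ⊆ interior (Isub i)
  hg_deriv : ∀ i, ∀ x ∈ ⋃ j, Isub j,
    HasDerivWithinAt (g i) (gder i x) (⋃ j, Isub j) x
  hgder_ne : ∀ i, ∀ x ∈ ⋃ j, Isub j, gder i x ≠ 0
  hgder_cont : ∀ i, ContinuousOn (gder i) (⋃ j, Isub j)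
  /-- `log |g i'|` is Lipschitz on the domain -/
  hgder_lip : ∀ i, ∃ θ : ℝ, ∀ x ∈ ⋃ j, Isub j, ∀ y ∈ ⋃ j, Isub j,
    abs (Real.log (abs (gder i x)) - Real.log (abs (gder i y))) ≤ θ * |x - y|
  /-- the expanding map `f`, with `f (g i x) = x` -/
  f : ℝ → ℝ
  /-- the derivative `f'` of `f` on the ranges of the `g i` -/
  fder : ℝ → ℝ
  hf : ∀ i, ∀ x ∈ ⋃ j, Isub j, f (g i x) = x
  hfder : ∀ i, ∀ x ∈ ⋃ j, Isub j, fder (g i x) = (gder i x)⁻¹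
  /-- the generator (expansivity) condition: `d_n → 0` -/
  hgen : ∀ ε : ℝ, 0 < ε → ∃ N : ℕ, ∀ w : List (Fin p), N ≤ w.length →
    Metric.diam (cylOf I Isub g w) < ε
  /-- the finite set of forbidden words -/
  Q : Finset (List (Fin p))
  /-- `Σ_Q` is completely invariant: `σ(Σ_Q) = Σ_Q` -/
  hQinv : ∀ ω : ℕ → Fin p, avoids Q ω →
    ∃ ω' : ℕ → Fin p, avoids Q ω' ∧ ∀ n : ℕ, ω' (n + 1) = ω n
  /-- `f|Λ_Q` is topologically transitive -/
  htrans : ∀ U V : Set ℝ, IsOpen U → IsOpen V →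
    (U ∩ limitSetOf I Isub g Q).Nonempty → (V ∩ limitSetOf I Isub g Q).Nonempty →
    ∃ n : ℕ, ∃ x ∈ U ∩ limitSetOf I Isub g Q, f^[n] x ∈ V

namespace ExpansiveMarkovSystem

variable {p : ℕ} (S : ExpansiveMarkovSystem p)

/-- The common domain `⋃ j, I_j` of the maps `g i`. -/
def dom : Set ℝ := ⋃ j, S.Isub j

/-- The cylinder `Δ_w` associated to the word `w`. -/
def cyl (w : List (Fin p)) : Set ℝ := cylOf S.I S.Isub S.g w

/-- The limit set `Λ_Q`. -/
def limitSet : Set ℝ := limitSetOf S.I S.Isub S.g S.Q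

/-- The domain of `f`, i.e. the union of the ranges of the `g i`. -/
def domF : Set ℝ := ⋃ i, S.g i '' S.dom

/-- The derivative `(fⁿ)'(x)` of the `n`-th iterate of `f` at `x`. -/
noncomputable def derIter (n : ℕ) (x : ℝ) : ℝ :=
  ∏ k ∈ Finset.range n, S.fder (S.f^[k] x)

/-- The Lyapunov exponent `χ(x) = limsup (1/n) log |(fⁿ)'(x)|`. -/
noncomputable def lyap (x : ℝ) : ℝ :=
  Filter.limsup (fun n : ℕ => Real.log |S.derIter n x| / n) Filter.atTop

/-- The set `H` of points of `Λ_Q` with infinitely many hyperbolic instants. -/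
def hypSet : Set ℝ :=
  { x ∈ S.limitSet | ∃ c₁ : ℝ, 0 < c₁ ∧ ∃ c₂ : ℝ, 0 < c₂ ∧
      ∃ n : ℕ → ℕ, StrictMono n ∧
        ∃ r : ℕ → ℝ, (∀ k, 0 < r k) ∧ Antitone r ∧
          Filter.Tendsto r Filter.atTop (nhds 0) ∧
          ∀ k : ℕ,
            (∀ y ∈ Metric.ball x (r k), ∀ j < n k, S.f^[j] y ∈ S.domF) ∧
            c₁ < Metric.diam (S.f^[n k] '' Metric.ball x (r k)) ∧
            (∀ y ∈ Metric.ball x (r k), ∀ z ∈ Metric.ball x (r k),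
              |S.derIter (n k) y| / |S.derIter (n k) z| < c₂) }

/-- `x` is a parabolic periodic point: `f^m(x) = x` and `|(f^m)'(x)| = 1`. -/
def IsParabolicPeriodic (x : ℝ) : Prop :=
  x ∈ S.limitSet ∧ ∃ m : ℕ, 1 ≤ m ∧ S.f^[m] x = x ∧ |S.derIter m x| = 1

/-- `ν` is a `t`-conformal (Borel probability) measure supported on `Λ_Q`. -/
def IsConformal (ν : Measure ℝ) (t : ℝ) : Prop :=
  IsProbabilityMeasure ν ∧ ν S.limitSetᶜ = 0 ∧
    ∀ A : Set ℝ, MeasurableSet A → A ⊆ S.limitSet → Set.InjOn S.f A →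
      ν (S.f '' A) = ∫⁻ x in A, ENNReal.ofReal (|S.fder x| ^ t) ∂ν

/-- `t_c = inf {t ≥ 0 : a t-conformal measure on Λ_Q exists}`. -/
noncomputable def tc : ℝ :=
  sInf { t : ℝ | 0 ≤ t ∧ ∃ ν : Measure ℝ, S.IsConformal ν t }

/-- `n` is a hyperbolic time for `x` with exponent `α`. -/
def IsHypTime (α : ℝ) (x : ℝ) (n : ℕ) : Prop :=
  ∀ k : ℕ, 1 ≤ k → k ≤ n → Real.exp (k * α) ≤ |S.derIter k (S.f^[n - k] x)|

/-- `H_HT(α)`: the points of `Λ_Q` with infinitely many hyperbolic times with exponent `α`. -/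
def HHT (α : ℝ) : Set ℝ :=
  { x ∈ S.limitSet | ∀ N : ℕ, ∃ n : ℕ, N ≤ n ∧ S.IsHypTime α x n }

end ExpansiveMarkovSystem

/-- The sequence `ξ` with its first `n` letters removed. -/
def shiftSeq {p : ℕ} (n : ℕ) (ξ : ℕ → Fin p) : ℕ → Fin p := fun k => ξ (n + k)

/-- The sequence `ξ` preceded by the letter `i`. -/
def consSeq {p : ℕ} (i : Fin p) (ξ : ℕ → Fin p) : ℕ → Fin p
  | 0 => i
  | k + 1 => ξ k

section Sequences

variable {p : ℕ}

@[simp] lemma shiftSeq_apply (n k : ℕ) (ξ : ℕ → Fin p) : shiftSeq n ξ k = ξ (n + k) := rfl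

@[simp] lemma shiftSeq_zero (ξ : ℕ → Fin p) : shiftSeq 0 ξ = ξ := by
  funext k; simp

lemma shiftSeq_shiftSeq (m n : ℕ) (ξ : ℕ → Fin p) :
    shiftSeq m (shiftSeq n ξ) = shiftSeq (n + m) ξ := by
  funext k; simp [add_assoc]

@[simp] lemma consSeq_zero (i : Fin p) (ξ : ℕ → Fin p) : consSeq i ξ 0 = i := rfl

@[simp] lemma consSeq_succ (i : Fin p) (ξ : ℕ → Fin p) (k : ℕ) : consSeq i ξ (k + 1) = ξ k := rfl

@[simp] lemma shiftSeq_one_consSeq (i : Fin p) (ξ : ℕ → Fin p) :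
    shiftSeq 1 (consSeq i ξ) = ξ := by
  funext k; simp [add_comm 1 k]

lemma consSeq_head_shiftSeq (ξ : ℕ → Fin p) : consSeq (ξ 0) (shiftSeq 1 ξ) = ξ := by
  funext k; cases k <;> simp [add_comm]

end Sequences

namespace ExpansiveMarkovSystem

variable {p : ℕ} (S : ExpansiveMarkovSystem p)

lemma Isub_subset_dom (i : Fin p) : S.Isub i ⊆ S.dom := subset_iUnion _ i

lemma dom_subset_I : S.dom ⊆ S.I := iUnion_subset S.hsubI

lemma isCompact_I : IsCompact S.I := by
  obtain ⟨a, b, -, h⟩ := S.hI; rw [h]; exact isCompact_Icc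

lemma isCompact_Isub (i : Fin p) : IsCompact (S.Isub i) := by
  obtain ⟨a, b, -, h⟩ := S.hIsub i; rw [h]; exact isCompact_Icc

lemma ordConnected_Isub (i : Fin p) : (S.Isub i).OrdConnected := by
  obtain ⟨a, b, -, h⟩ := S.hIsub i; rw [h]; exact ordConnected_Icc

lemma isCompact_dom : IsCompact S.dom := isCompact_iUnion S.isCompact_Isub

lemma g_mem_Isub (i : Fin p) {x : ℝ} (hx : x ∈ S.dom) : S.g i x ∈ interior (S.Isub i) :=
  S.hg_range i ⟨x, hx, rfl⟩

lemma g_mem_dom (i : Fin p) {x : ℝ} (hx : x ∈ S.dom) : S.g i x ∈ S.dom :=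
  S.Isub_subset_dom i (interior_subset (S.g_mem_Isub i hx))

lemma continuousOn_g (i : Fin p) : ContinuousOn (S.g i) S.dom :=
  fun x hx => (S.hg_deriv i x hx).continuousWithinAt

lemma eq_of_mem_Isub {i j : Fin p} {x : ℝ} (hi : x ∈ S.Isub i) (hj : x ∈ S.Isub j) : i = j := by
  by_contra h
  exact disjoint_left.1 (S.hdisj i j h) hi hj

lemma abs_sub_le_diam_I {x y : ℝ} (hx : x ∈ S.dom) (hy : y ∈ S.dom) : |x - y| ≤ diam S.I := by
  rw [← Real.dist_eq]
  exact dist_le_diam_of_mem S.isCompact_I.isBounded (S.dom_subset_I hx) (S.dom_subset_I hy)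

lemma diam_I_pos : 0 < diam S.I := by
  obtain ⟨a, b, h, h'⟩ := S.hI
  rw [h', Real.diam_Icc h.le]; linarith

lemma exists_uniform_lipschitz : ∃ θ : ℝ, 0 ≤ θ ∧ ∀ i, ∀ x ∈ S.dom, ∀ y ∈ S.dom,
    abs (Real.log |S.gder i x| - Real.log |S.gder i y|) ≤ θ * |x - y| := by
  choose θ hθ using S.hgder_lip
  refine ⟨∑ i, |θ i|, by positivity, fun i x hx y hy => (hθ i x hx y hy).trans ?_⟩
  gcongr
  exact (le_abs_self _).trans
    (Finset.single_le_sum (f := fun i => |θ i|) (fun _ _ => abs_nonneg _) (Finset.mem_univ i))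

/-- A common Lipschitz constant of the functions `log |gᵢ'|`. -/
noncomputable def lipConst : ℝ := S.exists_uniform_lipschitz.choose

lemma lipConst_nonneg : 0 ≤ S.lipConst := S.exists_uniform_lipschitz.choose_spec.1

lemma abs_log_gder_sub_le (i : Fin p) {x y : ℝ} (hx : x ∈ S.dom) (hy : y ∈ S.dom) :
    abs (Real.log |S.gder i x| - Real.log |S.gder i y|) ≤ S.lipConst * |x - y| :=
  S.exists_uniform_lipschitz.choose_spec.2 i x hx y hy

lemma exists_log_bound : ∃ B : ℝ, 0 ≤ B ∧ ∀ i, ∀ x ∈ S.dom, abs (Real.log |S.gder i x|) ≤ B := by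
  have h : ∀ i, ∃ B, ∀ x ∈ S.dom, ‖Real.log |S.gder i x|‖ ≤ B := fun i =>
    S.isCompact_dom.exists_bound_of_continuousOn
      (((S.hgder_cont i).abs).log fun x hx => abs_ne_zero.2 (S.hgder_ne i x hx))
  choose B hB using h
  refine ⟨∑ i, |B i|, by positivity, fun i x hx => (hB i x hx).trans ?_⟩
  exact (le_abs_self _).trans
    (Finset.single_le_sum (f := fun i => |B i|) (fun _ _ => abs_nonneg _) (Finset.mem_univ i))

/-- A common bound of the functions `log |gᵢ'|`. -/
noncomputable def logBound : ℝ := S.exists_log_bound.choose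

lemma logBound_nonneg : 0 ≤ S.logBound := S.exists_log_bound.choose_spec.1

lemma abs_log_gder_le (i : Fin p) {x : ℝ} (hx : x ∈ S.dom) :
    abs (Real.log |S.gder i x|) ≤ S.logBound := S.exists_log_bound.choose_spec.2 i x hx

lemma abs_gder_pos (i : Fin p) {x : ℝ} (hx : x ∈ S.dom) : 0 < |S.gder i x| :=
  abs_pos.2 (S.hgder_ne i x hx)

/-- The composition `g_{ξ₀} ∘ ⋯ ∘ g_{ξ_{n-1}}`. -/
def comp : ℕ → (ℕ → Fin p) → ℝ → ℝ
  | 0, _ => id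
  | n + 1, ξ => S.g (ξ 0) ∘ comp n (shiftSeq 1 ξ)

/-- The derivative of `comp n ξ`. -/
def compDer : ℕ → (ℕ → Fin p) → ℝ → ℝ
  | 0, _, _ => 1
  | n + 1, ξ, y => S.gder (ξ 0) (S.comp n (shiftSeq 1 ξ) y) * compDer n (shiftSeq 1 ξ) y

@[simp] lemma comp_zero (ξ : ℕ → Fin p) (y : ℝ) : S.comp 0 ξ y = y := rfl

lemma comp_succ (n : ℕ) (ξ : ℕ → Fin p) (y : ℝ) :
    S.comp (n + 1) ξ y = S.g (ξ 0) (S.comp n (shiftSeq 1 ξ) y) := rfl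

@[simp] lemma compDer_zero (ξ : ℕ → Fin p) (y : ℝ) : S.compDer 0 ξ y = 1 := rfl

lemma compDer_succ (n : ℕ) (ξ : ℕ → Fin p) (y : ℝ) : S.compDer (n + 1) ξ y =
    S.gder (ξ 0) (S.comp n (shiftSeq 1 ξ) y) * S.compDer n (shiftSeq 1 ξ) y := rfl

lemma comp_add (m n : ℕ) (ξ : ℕ → Fin p) (y : ℝ) :
    S.comp (m + n) ξ y = S.comp m ξ (S.comp n (shiftSeq m ξ) y) := by
  induction m generalizing ξ with
  | zero => simp
  | succ m ih =>
    rw [Nat.add_right_comm, comp_succ, comp_succ, ih, shiftSeq_shiftSeq,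
      add_comm 1 m]

lemma compDer_add (m n : ℕ) (ξ : ℕ → Fin p) (y : ℝ) : S.compDer (m + n) ξ y =
    S.compDer m ξ (S.comp n (shiftSeq m ξ) y) * S.compDer n (shiftSeq m ξ) y := by
  induction m generalizing ξ with
  | zero => simp
  | succ m ih =>
    rw [Nat.add_right_comm, compDer_succ, compDer_succ, ih, shiftSeq_shiftSeq,
      add_comm 1 m, comp_add, shiftSeq_shiftSeq, add_comm 1 m, mul_assoc]

lemma comp_one (ξ : ℕ → Fin p) (y : ℝ) : S.comp 1 ξ y = S.g (ξ 0) y := rfl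

lemma comp_succ_right (n : ℕ) (ξ : ℕ → Fin p) (y : ℝ) :
    S.comp (n + 1) ξ y = S.comp n ξ (S.g (ξ n) y) := by
  rw [comp_add, comp_one, shiftSeq_apply, add_zero]

lemma compDer_succ_right (n : ℕ) (ξ : ℕ → Fin p) (y : ℝ) :
    S.compDer (n + 1) ξ y = S.compDer n ξ (S.g (ξ n) y) * S.gder (ξ n) y := by
  rw [compDer_add, comp_one, compDer_succ]; simp

lemma comp_congr {n : ℕ} {ξ η : ℕ → Fin p} (h : ∀ k < n, ξ k = η k) : S.comp n ξ = S.comp n η := by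
  induction n generalizing ξ η with
  | zero => rfl
  | succ n ih =>
    funext y
    rw [comp_succ, comp_succ, h 0 n.succ_pos,
      ih (ξ := shiftSeq 1 ξ) (η := shiftSeq 1 η) fun k hk => h _ (by lia)]

lemma comp_mem_dom (n : ℕ) (ξ : ℕ → Fin p) {y : ℝ} (hy : y ∈ S.dom) : S.comp n ξ y ∈ S.dom := by
  induction n generalizing ξ with
  | zero => exact hy
  | succ n ih => exact S.g_mem_dom _ (ih _)

lemma comp_mem_Isub (n : ℕ) (ξ : ℕ → Fin p) {y : ℝ} (hy : y ∈ S.Isub (ξ n)) :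
    S.comp n ξ y ∈ S.Isub (ξ 0) := by
  cases n with
  | zero => exact hy
  | succ n =>
    exact interior_subset (S.g_mem_Isub _ (S.comp_mem_dom _ _ (S.Isub_subset_dom _ hy)))

lemma injOn_comp (n : ℕ) (ξ : ℕ → Fin p) : InjOn (S.comp n ξ) S.dom := by
  induction n generalizing ξ with
  | zero => exact injOn_id _
  | succ n ih =>
    exact (S.hg_inj _).comp (ih _) fun y hy => S.comp_mem_dom _ _ hy

lemma hasDerivWithinAt_comp (n : ℕ) (ξ : ℕ → Fin p) {y : ℝ} (hy : y ∈ S.dom) :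
    HasDerivWithinAt (S.comp n ξ) (S.compDer n ξ y) S.dom y := by
  induction n generalizing ξ with
  | zero => exact hasDerivWithinAt_id _ _
  | succ n ih =>
    exact (S.hg_deriv (ξ 0) _ (S.comp_mem_dom n _ hy)).comp y (ih _)
      fun z hz => S.comp_mem_dom _ _ hz

lemma continuousOn_comp (n : ℕ) (ξ : ℕ → Fin p) : ContinuousOn (S.comp n ξ) S.dom :=
  fun _ hy => (S.hasDerivWithinAt_comp n ξ hy).continuousWithinAt

lemma compDer_ne_zero (n : ℕ) (ξ : ℕ → Fin p) {y : ℝ} (hy : y ∈ S.dom) :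
    S.compDer n ξ y ≠ 0 := by
  induction n generalizing ξ with
  | zero => simp
  | succ n ih => exact mul_ne_zero (S.hgder_ne _ _ (S.comp_mem_dom _ _ hy)) (ih _)

lemma abs_compDer_pos (n : ℕ) (ξ : ℕ → Fin p) {y : ℝ} (hy : y ∈ S.dom) :
    0 < |S.compDer n ξ y| := abs_pos.2 (S.compDer_ne_zero n ξ hy)

lemma log_abs_compDer_succ (n : ℕ) (ξ : ℕ → Fin p) {y : ℝ} (hy : y ∈ S.dom) :
    Real.log |S.compDer (n + 1) ξ y| =
      Real.log |S.gder (ξ 0) (S.comp n (shiftSeq 1 ξ) y)| +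
        Real.log |S.compDer n (shiftSeq 1 ξ) y| := by
  rw [compDer_succ, abs_mul, Real.log_mul (S.abs_gder_pos _ (S.comp_mem_dom _ _ hy)).ne'
    (S.abs_compDer_pos _ _ hy).ne']

/-- Mean value theorem for `comp n ξ` on one of the intervals. -/
lemma exists_abs_comp_sub_eq (n : ℕ) (ξ : ℕ → Fin p) {i : Fin p} {x y : ℝ} (hx : x ∈ S.Isub i)
    (hy : y ∈ S.Isub i) :
    ∃ c ∈ uIcc x y, |S.comp n ξ x - S.comp n ξ y| = |S.compDer n ξ c| * |x - y| := by
  wlog hxy : x ≤ y generalizing x y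
  · obtain ⟨c, hc, h⟩ := this hy hx (le_of_not_ge hxy)
    exact ⟨c, uIcc_comm x y ▸ hc, by rw [abs_sub_comm, h, abs_sub_comm x y]⟩
  rcases hxy.eq_or_lt with rfl | hlt
  · exact ⟨x, by simp, by simp⟩
  have hsub : Icc x y ⊆ S.Isub i := (S.ordConnected_Isub i).out hx hy
  obtain ⟨c, hc, h⟩ := exists_hasDerivAt_eq_slope (S.comp n ξ) (S.compDer n ξ) hlt
    ((S.continuousOn_comp n ξ).mono (hsub.trans (S.Isub_subset_dom i))) fun z hz =>
      (S.hasDerivWithinAt_comp n ξ (S.Isub_subset_dom i (hsub (Ioo_subset_Icc_self hz)))).hasDerivAt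
        (mem_of_superset (Ioo_mem_nhds hz.1 hz.2)
          (Ioo_subset_Icc_self.trans (hsub.trans (S.Isub_subset_dom i))))
  refine ⟨c, by rw [uIcc_of_le hlt.le]; exact Ioo_subset_Icc_self hc, ?_⟩
  have hne : y - x ≠ 0 := by linarith
  rw [h, abs_sub_comm x y, ← abs_mul, div_mul_cancel₀ _ hne, abs_sub_comm]

lemma uIcc_subset_Isub {i : Fin p} {x y : ℝ} (hx : x ∈ S.Isub i) (hy : y ∈ S.Isub i) :
    uIcc x y ⊆ S.Isub i := (S.ordConnected_Isub i).uIcc_subset hx hy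

/-- The sum of the distances of the images of `y` and `z` along the compositions of tails
of `ξ`. -/
def orbitDist : ℕ → (ℕ → Fin p) → ℝ → ℝ → ℝ
  | 0, _, _, _ => 0
  | n + 1, ξ, y, z =>
    |S.comp n (shiftSeq 1 ξ) y - S.comp n (shiftSeq 1 ξ) z| + orbitDist n (shiftSeq 1 ξ) y z

lemma orbitDist_succ (n : ℕ) (ξ : ℕ → Fin p) (y z : ℝ) : S.orbitDist (n + 1) ξ y z =
    |S.comp n (shiftSeq 1 ξ) y - S.comp n (shiftSeq 1 ξ) z| +
      S.orbitDist n (shiftSeq 1 ξ) y z := rfl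

lemma abs_log_compDer_sub_le (n : ℕ) (ξ : ℕ → Fin p) {y z : ℝ} (hy : y ∈ S.dom)
    (hz : z ∈ S.dom) : abs (Real.log |S.compDer n ξ y| - Real.log |S.compDer n ξ z|) ≤
      S.lipConst * S.orbitDist n ξ y z := by
  induction n generalizing ξ with
  | zero => simp [orbitDist]
  | succ n ih =>
    rw [S.log_abs_compDer_succ n ξ hy, S.log_abs_compDer_succ n ξ hz, orbitDist_succ, mul_add,
      add_sub_add_comm]
    exact (abs_add_le _ _).trans (add_le_add (S.abs_log_gder_sub_le _ (S.comp_mem_dom _ _ hy)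
      (S.comp_mem_dom _ _ hz)) (ih _))

lemma abs_compDer_le_exp_mul (n : ℕ) (ξ : ℕ → Fin p) {y z D : ℝ} (hy : y ∈ S.dom)
    (hz : z ∈ S.dom) (hD : S.orbitDist n ξ y z ≤ D) :
    |S.compDer n ξ y| ≤ Real.exp (S.lipConst * D) * |S.compDer n ξ z| := by
  have h := (le_abs_self _).trans (S.abs_log_compDer_sub_le n ξ hy hz)
  have h' := mul_le_mul_of_nonneg_left hD S.lipConst_nonneg
  rw [← Real.exp_log (S.abs_compDer_pos n ξ hy), ← Real.exp_log (S.abs_compDer_pos n ξ hz),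
    ← Real.exp_add]
  exact Real.exp_le_exp.2 (by linarith)

/-- The cylinder of the sequences sharing the letters `ξ₀, …, ξₙ`. -/
def cylinder (ξ : ℕ → Fin p) (n : ℕ) : Set ℝ := S.comp n ξ '' S.Isub (ξ n)

lemma cylinder_zero (ξ : ℕ → Fin p) : S.cylinder ξ 0 = S.Isub (ξ 0) := image_id _

lemma cylinder_succ (ξ : ℕ → Fin p) (n : ℕ) :
    S.cylinder ξ (n + 1) = S.g (ξ 0) '' S.cylinder (shiftSeq 1 ξ) n := by
  rw [cylinder, cylinder, ← image_comp, shiftSeq_apply, add_comm 1 n]; rfl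

lemma cylinder_congr {n : ℕ} {ξ η : ℕ → Fin p} (h : ∀ k ≤ n, ξ k = η k) :
    S.cylinder ξ n = S.cylinder η n := by
  rw [cylinder, cylinder, S.comp_congr fun k hk => h k hk.le, h n le_rfl]

lemma cylinder_subset_Isub (ξ : ℕ → Fin p) (n : ℕ) : S.cylinder ξ n ⊆ S.Isub (ξ 0) := by
  rintro _ ⟨y, hy, rfl⟩
  exact S.comp_mem_Isub n ξ hy

lemma cylinder_subset_dom (ξ : ℕ → Fin p) (n : ℕ) : S.cylinder ξ n ⊆ S.dom :=
  (S.cylinder_subset_Isub ξ n).trans (S.Isub_subset_dom _)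

lemma comp_succ_mem_cylinder (ξ : ℕ → Fin p) (n : ℕ) {y : ℝ} (hy : y ∈ S.dom) :
    S.comp (n + 1) ξ y ∈ S.cylinder ξ n := by
  rw [comp_succ_right]
  exact ⟨_, interior_subset (S.g_mem_Isub _ hy), rfl⟩

lemma cylinder_succ_subset (ξ : ℕ → Fin p) (n : ℕ) :
    S.cylinder ξ (n + 1) ⊆ S.cylinder ξ n := by
  rintro _ ⟨y, hy, rfl⟩
  exact S.comp_succ_mem_cylinder ξ n (S.Isub_subset_dom _ hy)

lemma antitone_cylinder (ξ : ℕ → Fin p) : Antitone (S.cylinder ξ) :=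
  antitone_nat_of_succ_le (S.cylinder_succ_subset ξ)

lemma isCompact_cylinder (ξ : ℕ → Fin p) (n : ℕ) : IsCompact (S.cylinder ξ n) :=
  (S.isCompact_Isub _).image_of_continuousOn
    ((S.continuousOn_comp n ξ).mono (S.Isub_subset_dom _))

lemma nonempty_Isub (i : Fin p) : (S.Isub i).Nonempty := by
  obtain ⟨a, b, h, h'⟩ := S.hIsub i; rw [h']; exact nonempty_Icc.2 h.le

lemma nonempty_cylinder (ξ : ℕ → Fin p) (n : ℕ) : (S.cylinder ξ n).Nonempty :=
  (S.nonempty_Isub _).image _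

lemma exists_cylinder_eq_Icc (ξ : ℕ → Fin p) (n : ℕ) :
    ∃ a b : ℝ, a ≤ b ∧ S.cylinder ξ n = Icc a b := by
  have hc : IsConnected (S.cylinder ξ n) :=
    IsConnected.image ⟨S.nonempty_Isub _, (S.ordConnected_Isub _).isPreconnected⟩ _
      ((S.continuousOn_comp n ξ).mono (S.Isub_subset_dom _))
  have h := eq_Icc_of_connected_compact hc (S.isCompact_cylinder ξ n)
  refine ⟨_, _, ?_, h⟩
  exact nonempty_Icc.1 (h ▸ S.nonempty_cylinder ξ n)

/-- The length of a cylinder. -/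
noncomputable def len (ξ : ℕ → Fin p) (n : ℕ) : ℝ := diam (S.cylinder ξ n)

lemma len_nonneg (ξ : ℕ → Fin p) (n : ℕ) : 0 ≤ S.len ξ n := diam_nonneg

lemma len_congr {n : ℕ} {ξ η : ℕ → Fin p} (h : ∀ k ≤ n, ξ k = η k) : S.len ξ n = S.len η n := by
  rw [len, len, S.cylinder_congr h]

lemma len_le (ξ : ℕ → Fin p) (n : ℕ) : S.len ξ n ≤ diam S.I :=
  diam_mono ((S.cylinder_subset_dom ξ n).trans S.dom_subset_I) S.isCompact_I.isBounded

lemma volume_cylinder (ξ : ℕ → Fin p) (n : ℕ) :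
    volume (S.cylinder ξ n) = ENNReal.ofReal (S.len ξ n) := by
  obtain ⟨a, b, h, h'⟩ := S.exists_cylinder_eq_Icc ξ n
  rw [len, h', Real.volume_Icc, Real.diam_Icc h]

lemma abs_sub_le_len {ξ : ℕ → Fin p} {n : ℕ} {x y : ℝ} (hx : x ∈ S.cylinder ξ n)
    (hy : y ∈ S.cylinder ξ n) : |x - y| ≤ S.len ξ n := by
  rw [← Real.dist_eq]
  exact dist_le_diam_of_mem (S.isCompact_cylinder ξ n).isBounded hx hy

lemma cylinder_eq_cyl (ξ : ℕ → Fin p) (n : ℕ) : S.cylinder ξ n = S.cyl (wordOf ξ (n + 1)) := by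
  induction n generalizing ξ with
  | zero => rw [cylinder_zero]; rfl
  | succ n ih =>
    have h : ∀ m, wordOf ξ (m + 1) = ξ 0 :: wordOf (shiftSeq 1 ξ) m := fun m => by
      simp [wordOf, List.range_succ_eq_map, Function.comp_def, add_comm]
    rw [cylinder_succ, ih, h (n + 1)]
    have h' : wordOf (shiftSeq 1 ξ) (n + 1) =
        ξ 1 :: wordOf (shiftSeq 1 (shiftSeq 1 ξ)) n := by
      simp [wordOf, List.range_succ_eq_map, Function.comp_def, add_comm]
    rw [h']; rfl

lemma exists_len_lt {ε : ℝ} (hε : 0 < ε) : ∃ N, ∀ ξ : ℕ → Fin p, ∀ n ≥ N, S.len ξ n < ε := by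
  obtain ⟨N, hN⟩ := S.hgen ε hε
  refine ⟨N, fun ξ n hn => ?_⟩
  rw [len, cylinder_eq_cyl]
  exact hN _ (by simp [wordOf]; lia)

/-- Points of two cylinders determine the common letters. -/
lemma eq_of_mem_cylinder {ξ η : ℕ → Fin p} {m n : ℕ} {x : ℝ} (hx : x ∈ S.cylinder ξ m)
    (hy : x ∈ S.cylinder η n) : ∀ k, k ≤ m → k ≤ n → ξ k = η k := by
  intro k
  induction k generalizing ξ η m n x with
  | zero =>
    intro _ _
    exact S.eq_of_mem_Isub (S.cylinder_subset_Isub ξ m hx) (S.cylinder_subset_Isub η n hy)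
  | succ k ih =>
    intro hm hn
    obtain ⟨m, rfl⟩ : ∃ m', m = m' + 1 := ⟨m - 1, by lia⟩
    obtain ⟨n, rfl⟩ : ∃ n', n = n' + 1 := ⟨n - 1, by lia⟩
    have h0 := S.eq_of_mem_Isub (S.cylinder_subset_Isub ξ _ hx) (S.cylinder_subset_Isub η _ hy)
    rw [cylinder_succ] at hx hy
    obtain ⟨y, hy', rfl⟩ := hx
    obtain ⟨z, hz, h⟩ := hy
    rw [← h0] at h
    have hyz := S.hg_inj _ (S.cylinder_subset_dom _ _ hz) (S.cylinder_subset_dom _ _ hy') h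
    subst hyz
    have := ih hy' hz (by lia) (by lia)
    simpa [add_comm 1 k] using this

/-- The point of `ℝ` coded by `ξ`. -/
lemma exists_code (ξ : ℕ → Fin p) : ∃ x, ∀ n, x ∈ S.cylinder ξ n := by
  obtain ⟨x, hx⟩ := IsCompact.nonempty_iInter_of_sequence_nonempty_isCompact_isClosed
    (S.cylinder ξ) (S.cylinder_succ_subset ξ) (S.nonempty_cylinder ξ) (S.isCompact_cylinder ξ 0)
    fun n => (S.isCompact_cylinder ξ n).isClosed
  exact ⟨x, mem_iInter.1 hx⟩

/-- The coding map. -/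
noncomputable def code (ξ : ℕ → Fin p) : ℝ := (S.exists_code ξ).choose

lemma code_mem_cylinder (ξ : ℕ → Fin p) (n : ℕ) : S.code ξ ∈ S.cylinder ξ n :=
  (S.exists_code ξ).choose_spec n

lemma code_mem_Isub (ξ : ℕ → Fin p) : S.code ξ ∈ S.Isub (ξ 0) :=
  S.cylinder_subset_Isub ξ 0 (S.code_mem_cylinder ξ 0)

lemma code_mem_dom (ξ : ℕ → Fin p) : S.code ξ ∈ S.dom := S.Isub_subset_dom _ (S.code_mem_Isub ξ)

lemma eq_code {ξ : ℕ → Fin p} {x : ℝ} (hx : ∀ n, x ∈ S.cylinder ξ n) : x = S.code ξ := by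
  by_contra h
  obtain ⟨N, hN⟩ := S.exists_len_lt (abs_pos.2 (sub_ne_zero.2 h))
  exact absurd (S.abs_sub_le_len (hx N) (S.code_mem_cylinder ξ N)) (not_le.2 (hN ξ N le_rfl))

lemma code_eq_g (ξ : ℕ → Fin p) : S.code ξ = S.g (ξ 0) (S.code (shiftSeq 1 ξ)) := by
  refine (S.eq_code fun n => ?_).symm
  refine S.cylinder_succ_subset ξ n ?_
  rw [cylinder_succ]
  exact ⟨_, S.code_mem_cylinder _ n, rfl⟩

lemma code_eq_comp (n : ℕ) (ξ : ℕ → Fin p) : S.code ξ = S.comp n ξ (S.code (shiftSeq n ξ)) := by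
  induction n generalizing ξ with
  | zero => simp
  | succ n ih =>
    rw [comp_succ, S.code_eq_g ξ, ih (shiftSeq 1 ξ), shiftSeq_shiftSeq, add_comm 1 n]

lemma f_code (ξ : ℕ → Fin p) : S.f (S.code ξ) = S.code (shiftSeq 1 ξ) := by
  rw [S.code_eq_g ξ]; exact S.hf _ _ (S.code_mem_dom _)

lemma iterate_f_code (n : ℕ) (ξ : ℕ → Fin p) :
    S.f^[n] (S.code ξ) = S.code (shiftSeq n ξ) := by
  induction n generalizing ξ with
  | zero => simp
  | succ n ih => rw [Function.iterate_succ_apply, f_code, ih, shiftSeq_shiftSeq, add_comm 1 n]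

lemma code_injective : Function.Injective S.code := fun ξ η h => by
  funext k
  exact S.eq_of_mem_cylinder (S.code_mem_cylinder ξ k) (h ▸ S.code_mem_cylinder η k) k le_rfl le_rfl

lemma abs_code_sub_le {ξ η : ℕ → Fin p} {n : ℕ} (h : ∀ k ≤ n, ξ k = η k) :
    |S.code ξ - S.code η| ≤ S.len ξ n :=
  S.abs_sub_le_len (S.code_mem_cylinder ξ n) (S.cylinder_congr h ▸ S.code_mem_cylinder η n)

lemma eventually_agree (ξ : ℕ → Fin p) (n : ℕ) : ∀ᶠ η in nhds ξ, ∀ k ≤ n, ξ k = η k := by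
  rw [show (fun η : ℕ → Fin p => ∀ k ≤ n, ξ k = η k) = fun η => ∀ k ∈ Finset.range (n + 1),
    ξ k = η k by funext η; simp]
  rw [Filter.eventually_all_finset]
  intro k _
  have : IsOpen {η : ℕ → Fin p | η k = ξ k} :=
    isOpen_discrete ({ξ k} : Set (Fin p)) |>.preimage (continuous_apply (A := fun _ => Fin p) k)
  filter_upwards [this.mem_nhds rfl] with η hη using hη.symm

lemma continuous_code : Continuous S.code := by
  refine continuous_iff_continuousAt.2 fun ξ => Metric.tendsto_nhds.2 fun ε hε => ?_
  obtain ⟨N, hN⟩ := S.exists_len_lt hε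
  filter_upwards [eventually_agree ξ N] with η hη
  rw [dist_comm, Real.dist_eq]
  exact (S.abs_code_sub_le hη).trans_lt (hN ξ N le_rfl)

lemma limitSet_eq : S.limitSet = S.code '' {ξ | avoids S.Q ξ} := by
  ext x
  constructor
  · rintro ⟨ξ, hξ, h⟩
    refine ⟨ξ, hξ, (S.eq_code fun n => ?_).symm⟩
    rw [cylinder_eq_cyl]; exact h _
  · rintro ⟨ξ, hξ, rfl⟩
    refine ⟨ξ, hξ, fun n => ?_⟩
    cases n with
    | zero => exact S.dom_subset_I (S.code_mem_dom ξ)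
    | succ n =>
      have := S.code_mem_cylinder ξ n
      rwa [cylinder_eq_cyl] at this

/-- The sum of the lengths of the cylinders `[ξ_k … ξ_n]`, `0 ≤ k ≤ n`. -/
noncomputable def lenSum (ξ : ℕ → Fin p) (n : ℕ) : ℝ :=
  ∑ k ∈ Finset.range (n + 1), S.len (shiftSeq k ξ) (n - k)

lemma lenSum_succ (ξ : ℕ → Fin p) (n : ℕ) :
    S.lenSum ξ (n + 1) = S.len ξ (n + 1) + S.lenSum (shiftSeq 1 ξ) n := by
  rw [lenSum, Finset.sum_range_succ', lenSum, add_comm]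
  simp [shiftSeq_shiftSeq, add_comm 1]

lemma lenSum_zero (ξ : ℕ → Fin p) : S.lenSum ξ 0 = S.len ξ 0 := by simp [lenSum]

lemma lenSum_congr {n : ℕ} {ξ η : ℕ → Fin p} (h : ∀ k ≤ n, ξ k = η k) :
    S.lenSum ξ n = S.lenSum η n :=
  Finset.sum_congr rfl fun k hk => S.len_congr fun j hj => by
    have := Finset.mem_range.1 hk
    exact h _ (by lia)

lemma orbitDist_add_len_le {ξ : ℕ → Fin p} {n : ℕ} {y z : ℝ} (hy : y ∈ S.Isub (ξ n))
    (hz : z ∈ S.Isub (ξ n)) : S.orbitDist n ξ y z + S.len ξ n ≤ S.lenSum ξ n := by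
  induction n generalizing ξ with
  | zero => simp [orbitDist, lenSum_zero]
  | succ n ih =>
    rw [orbitDist_succ, lenSum_succ]
    have hy' : y ∈ S.Isub (shiftSeq 1 ξ n) := by rwa [shiftSeq_apply, add_comm]
    have hz' : z ∈ S.Isub (shiftSeq 1 ξ n) := by rwa [shiftSeq_apply, add_comm]
    have := S.abs_sub_le_len (ξ := shiftSeq 1 ξ) (n := n) ⟨y, hy', rfl⟩ ⟨z, hz', rfl⟩
    linarith [ih hy' hz']

lemma orbitDist_le_lenSum {ξ : ℕ → Fin p} {n : ℕ} {y z : ℝ} (hy : y ∈ S.Isub (ξ n))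
    (hz : z ∈ S.Isub (ξ n)) : S.orbitDist n ξ y z ≤ S.lenSum ξ n := by
  linarith [S.orbitDist_add_len_le hy hz, S.len_nonneg ξ n]

lemma abs_compDer_le_of_lenSum_le {ξ : ℕ → Fin p} {n : ℕ} {y z D : ℝ} (hy : y ∈ S.Isub (ξ n))
    (hz : z ∈ S.Isub (ξ n)) (hD : S.lenSum ξ n ≤ D) :
    |S.compDer n ξ y| ≤ Real.exp (S.lipConst * D) * |S.compDer n ξ z| :=
  S.abs_compDer_le_exp_mul n ξ (S.Isub_subset_dom _ hy) (S.Isub_subset_dom _ hz)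
    ((S.orbitDist_le_lenSum hy hz).trans hD)

lemma len_le_mul {ξ : ℕ → Fin p} {n : ℕ} {M : ℝ}
    (hM : ∀ y ∈ S.Isub (ξ n), |S.compDer n ξ y| ≤ M) : S.len ξ n ≤ M * diam S.I := by
  have hM0 : 0 ≤ M := (abs_nonneg _).trans (hM _ (S.nonempty_Isub (ξ n)).some_mem)
  refine diam_le_of_forall_dist_le (mul_nonneg hM0 S.diam_I_pos.le) ?_
  rintro _ ⟨x, hx, rfl⟩ _ ⟨y, hy, rfl⟩
  obtain ⟨c, hc, h⟩ := S.exists_abs_comp_sub_eq n ξ hx hy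
  rw [Real.dist_eq, h]
  exact mul_le_mul (hM c (S.uIcc_subset_Isub hx hy hc))
    (S.abs_sub_le_diam_I (S.Isub_subset_dom _ hx) (S.Isub_subset_dom _ hy)) (abs_nonneg _) hM0

/-- Lengths of cylinders are controlled from above by the derivative. -/
lemma len_le_exp_mul {ξ : ℕ → Fin p} {n : ℕ} {y D : ℝ} (hy : y ∈ S.Isub (ξ n))
    (hD : S.lenSum ξ n ≤ D) :
    S.len ξ n ≤ Real.exp (S.lipConst * D) * |S.compDer n ξ y| * diam S.I :=
  S.len_le_mul fun _ hz => S.abs_compDer_le_of_lenSum_le hz hy hD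

/-- The sums of lengths grow subexponentially along each word. -/
lemma exists_lenSum_le {ε : ℝ} (hε : 0 < ε) : ∃ C, 0 ≤ C ∧ ∀ (n : ℕ) (ξ : ℕ → Fin p),
    S.lenSum ξ n ≤ ε * n + C := by
  obtain ⟨N, hN⟩ := S.exists_len_lt hε
  refine ⟨(N + 1) * diam S.I, by have := S.diam_I_pos; positivity, fun n => ?_⟩
  have hD := S.diam_I_pos
  by_cases hn : n ≤ N
  · intro ξ
    have h1 : S.lenSum ξ n ≤ (n + 1) * diam S.I := by
      refine (Finset.sum_le_card_nsmul _ _ (diam S.I) fun k _ => S.len_le _ _).trans ?_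
      simp
    have : (n : ℝ) ≤ N := by exact_mod_cast hn
    have : 0 ≤ ε * n := by positivity
    nlinarith
  · induction n with
    | zero => lia
    | succ n ih =>
      intro ξ
      have h1 := hN ξ (n + 1) (by lia)
      rw [lenSum_succ]
      by_cases hn' : n ≤ N
      · have h2 : S.lenSum (shiftSeq 1 ξ) n ≤ (n + 1) * diam S.I := by
          refine (Finset.sum_le_card_nsmul _ _ (diam S.I) fun k _ => S.len_le _ _).trans ?_
          simp
        have : (n : ℝ) ≤ N := by exact_mod_cast hn'
        have : 0 ≤ ε * n := by positivity
        push_cast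
        nlinarith
      · push_cast
        linarith [ih hn' (shiftSeq 1 ξ)]

end ExpansiveMarkovSystem

/-- The sequences all of whose initial words occur infinitely often in `ξ`. -/
def recurrentSet {p : ℕ} (ξ : ℕ → Fin p) : Set (ℕ → Fin p) :=
  {η | ∀ m N : ℕ, ∃ k ≥ N, ∀ j ≤ m, ξ (k + j) = η j}

section Recurrent

variable {p : ℕ} {ξ : ℕ → Fin p}

lemma exists_mem_recurrentSet_of_le (n : ℕ → ℕ) (hn : ∀ N, N ≤ n N) :
    ∃ ζ ∈ recurrentSet ξ, ∀ m, ∃ᶠ N in atTop, ∀ j ≤ m, ξ (n N + j) = ζ j := by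
  obtain ⟨ζ, hζ⟩ := exists_clusterPt_of_compactSpace (map (fun N => shiftSeq (n N) ξ) atTop)
  have h : ∀ m, ∃ᶠ N in atTop, ∀ j ≤ m, ξ (n N + j) = ζ j := fun m =>
    ((mapClusterPt_iff_frequently.1 hζ) _
      (ExpansiveMarkovSystem.eventually_agree ζ m)).mono fun N hN j hj => (hN j hj).symm
  refine ⟨ζ, fun m N => ?_, h⟩
  obtain ⟨k, hk, hk'⟩ := (frequently_atTop.1 (h m)) N
  exact ⟨n k, hk.trans (hn k), hk'⟩

lemma recurrentSet_nonempty (ξ : ℕ → Fin p) : (recurrentSet ξ).Nonempty := by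
  obtain ⟨ζ, hζ, -⟩ := exists_mem_recurrentSet_of_le (ξ := ξ) id fun _ => le_rfl
  exact ⟨ζ, hζ⟩

lemma isCompact_recurrentSet (ξ : ℕ → Fin p) : IsCompact (recurrentSet ξ) := by
  refine IsClosed.isCompact (isClosed_of_closure_subset fun η hη m N => ?_)
  obtain ⟨η', h, h'⟩ := mem_closure_iff_nhds.1 hη _
    (ExpansiveMarkovSystem.eventually_agree η m)
  obtain ⟨k, hk, hk'⟩ := h' m N
  exact ⟨k, hk, fun j hj => (hk' j hj).trans (h j hj).symm⟩

lemma shiftSeq_mem_recurrentSet {η : ℕ → Fin p} (hη : η ∈ recurrentSet ξ) (n : ℕ) :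
    shiftSeq n η ∈ recurrentSet ξ := fun m N => by
  obtain ⟨k, hk, h⟩ := hη (n + m) N
  exact ⟨k + n, by lia, fun j hj => by rw [add_assoc, h _ (by lia), shiftSeq_apply]⟩

lemma exists_consSeq_mem_recurrentSet {η : ℕ → Fin p} (P : Fin p → Prop)
    (hP : ∀ N, ∃ k ≥ N, (∀ j ≤ N, ξ (k + 1 + j) = η j) ∧ P (ξ k)) :
    ∃ c, P c ∧ consSeq c η ∈ recurrentSet ξ := by
  choose n hn h hP using hP
  obtain ⟨ζ, hζ, h'⟩ := exists_mem_recurrentSet_of_le n hn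
  have hζη : shiftSeq 1 ζ = η := by
    funext j
    obtain ⟨N, hN, hN'⟩ := (frequently_atTop.1 (h' (1 + j))) j
    rw [shiftSeq_apply, ← hN' _ le_rfl, ← h N j hN, add_assoc]
  obtain ⟨N, -, hN⟩ := (frequently_atTop.1 (h' 0)) 0
  refine ⟨ζ 0, by rw [← hN 0 le_rfl]; exact hP N, ?_⟩
  rwa [← hζη, consSeq_head_shiftSeq]

lemma exists_shiftSeq_eq {η : ℕ → Fin p} (hη : η ∈ recurrentSet ξ) (n : ℕ) :
    ∃ ζ ∈ recurrentSet ξ, shiftSeq n ζ = η := by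
  induction n with
  | zero => exact ⟨η, hη, by simp⟩
  | succ n ih =>
    obtain ⟨ζ, hζ, rfl⟩ := ih
    obtain ⟨c, -, hc⟩ := exists_consSeq_mem_recurrentSet (ξ := ξ) (η := ζ)
        (fun _ => True) fun N => by
      obtain ⟨k, hk, h⟩ := hζ N (N + 1)
      exact ⟨k - 1, by lia, fun j hj => by rw [← h j hj]; congr 1; lia, trivial⟩
    exact ⟨_, hc, by rw [add_comm n 1, ← shiftSeq_shiftSeq, shiftSeq_one_consSeq]⟩

lemma shiftSeq_mul_eq {z : ℕ → Fin p} {P : ℕ} (hz : shiftSeq P z = z) (m : ℕ) :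
    shiftSeq (P * m) z = z := by
  induction m with
  | zero => simp
  | succ m ih => rw [Nat.mul_succ, ← shiftSeq_shiftSeq, ih, hz]

/-- If every shift of a periodic recurrent sequence `z` has a unique left extension in the
recurrent set, then `ξ` is eventually periodic. -/
lemma eventually_periodic_of_unique_extension {z : ℕ → Fin p} {P : ℕ} (hP : 0 < P)
    (hz : shiftSeq P z = z) (hzX : z ∈ recurrentSet ξ)
    (huniq : ∀ k c, consSeq c (shiftSeq k z) ∈ recurrentSet ξ → c = z (k + (P - 1))) :
    ∃ T, ∀ n ≥ T, ξ (n + P) = ξ n := by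
  have hper : ∀ j, z (P + j) = z j := fun j => congrFun hz j
  have hk : ∀ k, ∃ N, ∀ n ≥ N, (∀ j ≤ N, ξ (n + 1 + j) = z (k + j)) → ξ n = z (k + (P - 1)) := by
    intro k
    by_contra! h
    obtain ⟨c, hc, hc'⟩ := exists_consSeq_mem_recurrentSet (η := shiftSeq k z)
      (fun c => c ≠ z (k + (P - 1))) fun N => by simpa using h N
    exact hc (huniq k c hc')
  choose N hN using hk
  set M := ∑ k ∈ Finset.range P, N k with hM
  have hNM : ∀ k < P, N k ≤ M := fun k hk =>
    Finset.single_le_sum (f := N) (fun _ _ => Nat.zero_le _) (Finset.mem_range.2 hk)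
  have hmod : ∀ k j, z (k + j) = z (k % P + j) := fun k j => by
    have := congrFun (shiftSeq_mul_eq hz (k / P)) (k % P + j)
    rw [shiftSeq_apply, ← add_assoc, Nat.div_add_mod] at this
    exact this
  have hM' : ∀ k, ∀ n ≥ M, (∀ j ≤ M, ξ (n + 1 + j) = z (k + j)) → ξ n = z (k + (P - 1)) := by
    intro k n hn h
    have hlt := hNM _ (Nat.mod_lt k hP)
    rw [hmod]
    exact hN _ n (hlt.trans hn) fun j hj => by rw [h j (hj.trans hlt), hmod]
  have hback : ∀ d n, M ≤ n → (∀ j ≤ M, ξ (n + d + j) = z j) →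
      ∀ j ≤ M + d, ξ (n + j) = z (d * (P - 1) + j) := by
    intro d
    induction d with
    | zero => intro n _ h j hj; simpa using h j hj
    | succ d ih =>
      intro n hn h j hj
      have h1 := ih (n + 1) (by lia) fun j hj => by rw [← h j hj]; congr 1; lia
      cases j with
      | zero =>
        rw [add_zero, add_zero, hM' (d * (P - 1)) n hn fun j hj => h1 j (by lia)]
        congr 1; ring
      | succ j =>
        rw [show n + (j + 1) = n + 1 + j by ring, h1 j (by lia), ← hper]
        congr 1
        obtain ⟨P, rfl⟩ : ∃ P', P = P' + 1 := ⟨P - 1, by lia⟩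
        simp only [add_tsub_cancel_right]
        ring
  refine ⟨M, fun n hn => ?_⟩
  obtain ⟨k, hk, h⟩ := hzX M (n + P)
  obtain ⟨d, rfl⟩ := Nat.exists_eq_add_of_le (show n ≤ k by lia)
  have h2 := hback d n hn h
  have h3 := h2 P (by lia)
  have h4 := h2 0 (by lia)
  rw [add_zero] at h4
  rw [h3, h4, add_comm, hper, add_zero]

end Recurrent

lemma sum_measureReal_le_of_disjoint {ι : Type*} (s : Finset ι) (A : ι → Set ℝ) {l u : ℝ}
    (hlu : l ≤ u) (hA : ∀ i ∈ s, A i ⊆ Icc l u) (hm : ∀ i ∈ s, MeasurableSet (A i))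
    (hd : (s : Set ι).PairwiseDisjoint A) : ∑ i ∈ s, volume.real (A i) ≤ u - l := by
  have hfin : ∀ i ∈ s, volume (A i) ≠ ⊤ := fun i hi =>
    ((measure_mono (hA i hi)).trans_lt measure_Icc_lt_top).ne
  rw [← measureReal_biUnion_finset hd hm hfin]
  refine (measureReal_mono (iUnion₂_subset hA) measure_Icc_lt_top.ne).trans ?_
  rw [Real.volume_real_Icc_of_le hlu]

/-- Intervals with a marked endpoint that meets no other marked endpoint overlap at most twice. -/
lemma sum_abs_sub_le_of_gaps {ι : Type*} (s : Finset ι) (a q : ι → ℝ) {l u : ℝ} (hlu : l ≤ u)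
    (ha : ∀ i ∈ s, a i ∈ Icc l u) (hq : ∀ i ∈ s, q i ∈ Icc l u)
    (hgap : ∀ i ∈ s, ∀ j ∈ s, a j ∈ uIcc (a i) (q i) → i = j) :
    ∑ i ∈ s, |q i - a i| ≤ 2 * (u - l) := by
  have h : ∀ i ∈ s,
      |q i - a i| = volume.real (Ico (a i) (q i)) + volume.real (Ioc (q i) (a i)) := by
    intro i _
    rw [Real.volume_real_Ico, Real.volume_real_Ioc]
    rcases le_total (a i) (q i) with h | h
    · rw [abs_of_nonneg (by linarith), max_eq_left (by linarith), max_eq_right (by linarith),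
        add_zero]
    · rw [abs_of_nonpos (by linarith), max_eq_right (by linarith), max_eq_left (by linarith)]
      ring
  rw [Finset.sum_congr rfl h, Finset.sum_add_distrib, two_mul]
  refine add_le_add (sum_measureReal_le_of_disjoint s _ hlu
    (fun i hi x hx => ⟨(ha i hi).1.trans hx.1, hx.2.le.trans (hq i hi).2⟩)
    (fun _ _ => measurableSet_Ico) ?_) (sum_measureReal_le_of_disjoint s _ hlu
    (fun i hi x hx => ⟨(hq i hi).1.trans hx.1.le, hx.2.trans (ha i hi).2⟩)
    (fun _ _ => measurableSet_Ioc) ?_)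
  · intro i hi j hj hij
    refine disjoint_left.2 fun x hx hx' => hij ?_
    rcases le_total (a i) (a j) with h | h
    · exact hgap i hi j hj (mem_uIcc.2 (Or.inl ⟨h, hx'.1.trans hx.2.le⟩))
    · exact (hgap j hj i hi (mem_uIcc.2 (Or.inl ⟨h, hx.1.trans hx'.2.le⟩))).symm
  · intro i hi j hj hij
    refine disjoint_left.2 fun x hx hx' => hij ?_
    rcases le_total (a i) (a j) with h | h
    · exact (hgap j hj i hi (mem_uIcc.2 (Or.inr ⟨hx'.1.le.trans hx.2, h⟩))).symm
    · exact hgap i hi j hj (mem_uIcc.2 (Or.inr ⟨hx.1.le.trans hx'.2, h⟩))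

lemma abs_sub_le_of_mem_uIcc_of_injOn {φ : ℝ → ℝ} {a b c : ℝ} (hφ : ContinuousOn φ (uIcc a b))
    (hinj : InjOn φ (uIcc a b)) (hc : c ∈ uIcc a b) : |φ c - φ a| ≤ |φ b - φ a| := by
  have hmem : φ c ∈ uIcc (φ a) (φ b) := by
    wlog hab : a ≤ b generalizing a b
    · rw [uIcc_comm] at hφ hinj hc ⊢
      exact this hφ hinj hc (le_of_not_ge hab)
    rw [uIcc_of_le hab] at hφ hinj hc
    have ha : a ∈ Icc a b := left_mem_Icc.2 hab
    have hb : b ∈ Icc a b := right_mem_Icc.2 hab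
    rcases hφ.strictMonoOn_of_injOn_Icc' hab hinj with h | h
    · exact mem_uIcc.2 (Or.inl ⟨h.monotoneOn ha hc hc.1, h.monotoneOn hc hb hc.2⟩)
    · exact mem_uIcc.2 (Or.inr ⟨h.antitoneOn hc hb hc.2, h.antitoneOn ha hc hc.1⟩)
  exact abs_sub_left_of_mem_uIcc hmem

namespace ExpansiveMarkovSystem

variable {p : ℕ} (S : ExpansiveMarkovSystem p)

/-- The sum of lengths up to the first occurrence of a word is controlled by that word. -/
lemma lenSum_first_occurrence_le {ξ η : ℕ → Fin p} {k m : ℕ} (hk : ∀ j ≤ m, ξ (k + j) = η j)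
    (hmin : ∀ k' < k, ¬ ∀ j ≤ m, ξ (k' + j) = η j) :
    S.lenSum ξ (k + m) ≤ diam S.I + S.lenSum η m := by
  rw [lenSum, add_assoc, Finset.sum_range_add]
  refine add_le_add ?_ (Finset.sum_congr rfl fun j hj => ?_).le
  · obtain ⟨l, u, hlu, hI⟩ := S.hI
    rw [hI, Real.diam_Icc hlu.le]
    have h : ∀ j, S.len (shiftSeq j ξ) (k + m - j) =
        volume.real (S.cylinder (shiftSeq j ξ) (k + m - j)) := fun j => by
      rw [measureReal_def, volume_cylinder, ENNReal.toReal_ofReal (S.len_nonneg _ _)]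
    simp_rw [h]
    refine sum_measureReal_le_of_disjoint _ _ hlu.le
      (fun j _ => hI ▸ (S.cylinder_subset_dom _ _).trans S.dom_subset_I)
      (fun j _ => (S.isCompact_cylinder _ _).measurableSet) ?_
    intro i hi j hj hij
    wlog hlt : i < j generalizing i j
    · exact (this hj hi hij.symm (by lia)).symm
    refine disjoint_left.2 fun x hx hx' => ?_
    have hj' : j < k := Finset.mem_range.1 hj
    refine hmin (i + (k - j)) (by lia) fun l hl => ?_
    have := S.eq_of_mem_cylinder hx hx' (k - j + l) (by lia) (by lia)
    rw [shiftSeq_apply, shiftSeq_apply] at this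
    rw [add_assoc, this, ← hk l hl]
    congr 1; lia
  · have hj' := Finset.mem_range.1 hj
    rw [show k + m - (k + j) = m - j by lia]
    refine S.len_congr fun i hi => ?_
    rw [shiftSeq_apply, shiftSeq_apply, add_assoc, hk _ (by lia)]

/-- `q` witnesses a one-sided gap of the codes of `X` at the code of `η`. -/
def IsGap (X : Set (ℕ → Fin p)) (η : ℕ → Fin p) (q : ℝ) : Prop :=
  q ∈ S.Isub (η 0) ∧ q ≠ S.code η ∧
    ∀ ζ ∈ X, S.code ζ ∈ uIcc (S.code η) q → S.code ζ = S.code η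

variable {ξ : ℕ → Fin p}

lemma exists_isGap (ξ : ℕ → Fin p) : ∃ η ∈ recurrentSet ξ, ∃ q, S.IsGap (recurrentSet ξ) η q := by
  obtain ⟨z, hz⟩ := recurrentSet_nonempty ξ
  have hcl : IsClosed {η : ℕ → Fin p | η 0 = z 0} :=
    isClosed_eq (continuous_apply 0) continuous_const
  obtain ⟨η, ⟨hη, hη0⟩, hmax⟩ := ((isCompact_recurrentSet ξ).inter_right hcl).exists_isMaxOn
    ⟨z, hz, rfl⟩ S.continuous_code.continuousOn
  obtain ⟨a, b, hab, h⟩ := S.hIsub (η 0)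
  have hlt : S.code η < b := by
    have := S.g_mem_Isub (η 0) (S.code_mem_dom (shiftSeq 1 η))
    rw [← code_eq_g, h, interior_Icc] at this
    exact this.2
  refine ⟨η, hη, b, by rw [h]; exact right_mem_Icc.2 hab.le, hlt.ne', fun ζ hζ hmem => ?_⟩
  rw [uIcc_of_le hlt.le] at hmem
  have hζ0 : ζ 0 = η 0 := S.eq_of_mem_Isub (S.code_mem_Isub ζ)
    (by
      have := S.code_mem_Isub η
      rw [h] at this ⊢
      exact ⟨this.1.trans hmem.1, hmem.2⟩)
  exact le_antisymm (hmax ⟨hζ, hζ0.trans hη0⟩) hmem.1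

variable {S} in
lemma IsGap.of_shiftSeq_one {ζ : ℕ → Fin p} {q : ℝ}
    (h : S.IsGap (recurrentSet ξ) (shiftSeq 1 ζ) q) :
    S.IsGap (recurrentSet ξ) ζ (S.g (ζ 0) q) := by
  obtain ⟨hq, hne, hgap⟩ := h
  have hqd := S.Isub_subset_dom _ hq
  have hcd := S.code_mem_dom (shiftSeq 1 ζ)
  have hmem := interior_subset (S.g_mem_Isub (ζ 0) hqd)
  refine ⟨hmem, fun h => hne ?_, fun ω hω hω' => ?_⟩
  · rw [S.code_eq_g ζ] at h
    exact S.hg_inj _ hqd hcd h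
  · have hω0 : ω 0 = ζ 0 := S.eq_of_mem_Isub (S.code_mem_Isub ω)
      (S.uIcc_subset_Isub (S.code_mem_Isub ζ) hmem hω')
    have hsub := (S.uIcc_subset_Isub (S.code_mem_Isub (shiftSeq 1 ζ)) hq).trans
      (S.Isub_subset_dom _)
    rw [S.code_eq_g ω, S.code_eq_g ζ, hω0] at hω'
    obtain ⟨y, hy, hy'⟩ := intermediate_value_uIcc ((S.continuousOn_g (ζ 0)).mono hsub) hω'
    have := S.hg_inj _ (hsub hy) (S.code_mem_dom _) hy'
    subst this
    rw [S.code_eq_g ω, S.code_eq_g ζ, hω0,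
      hgap _ (shiftSeq_mem_recurrentSet hω 1) hy]

variable {S} in
lemma IsGap.of_shiftSeq {n : ℕ} {ζ : ℕ → Fin p} {q : ℝ}
    (h : S.IsGap (recurrentSet ξ) (shiftSeq n ζ) q) :
    S.IsGap (recurrentSet ξ) ζ (S.comp n ζ q) := by
  induction n generalizing ζ with
  | zero => simpa using h
  | succ n ih =>
    refine IsGap.of_shiftSeq_one (ih ?_)
    rwa [shiftSeq_shiftSeq, add_comm 1 n]

/-- If `ξ` is not eventually periodic, some nonperiodic recurrent sequence has a gap. -/
lemma exists_isGap_not_periodic (hξ : ¬ ∃ P > 0, ∃ T, ∀ n ≥ T, ξ (n + P) = ξ n) :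
    ∃ η ∈ recurrentSet ξ, ∃ q, S.IsGap (recurrentSet ξ) η q ∧ ∀ P > 0, shiftSeq P η ≠ η := by
  by_contra! hcon
  obtain ⟨z, hz, q, hq⟩ := S.exists_isGap ξ
  obtain ⟨P, hP, hper⟩ := hcon z hz q hq
  refine hξ ⟨P, hP, eventually_periodic_of_unique_extension hP hper hz fun k c hc => ?_⟩
  have hgap : S.IsGap (recurrentSet ξ) (consSeq c (shiftSeq k z))
      (S.comp (1 + (P * (k + 1) - k)) (consSeq c (shiftSeq k z)) q) := by
    refine IsGap.of_shiftSeq ?_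
    rw [← shiftSeq_shiftSeq, shiftSeq_one_consSeq, shiftSeq_shiftSeq,
      show k + (P * (k + 1) - k) = P * (k + 1) by have := Nat.le_mul_of_pos_left (k + 1) hP; lia,
      shiftSeq_mul_eq hper]
    exact hq
  obtain ⟨r, hr, hr'⟩ := hcon _ hc _ hgap
  have h1 := congrFun (shiftSeq_mul_eq hr' P) 0
  obtain ⟨r, rfl⟩ : ∃ r', r = r' + 1 := ⟨r - 1, by lia⟩
  obtain ⟨P, rfl⟩ : ∃ P', P = P' + 1 := ⟨P - 1, by lia⟩
  have h2 := congrFun (shiftSeq_mul_eq hper r) (k + P)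
  rw [shiftSeq_apply, add_zero, consSeq_zero,
    show (r + 1) * (P + 1) = ((P + 1) * r + P) + 1 by ring, consSeq_succ, shiftSeq_apply] at h1
  rw [shiftSeq_apply] at h2
  rw [← h1, add_tsub_cancel_right, ← h2]
  congr 1; ring

lemma orbitDist_mono {l : ℕ} {ζ : ℕ → Fin p} {a c q : ℝ} (ha : a ∈ S.Isub (ζ l))
    (hq : q ∈ S.Isub (ζ l)) (hc : c ∈ uIcc a q) :
    S.orbitDist l ζ c a ≤ S.orbitDist l ζ q a := by
  induction l generalizing ζ with
  | zero => rfl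
  | succ l ih =>
    have hsub := (S.uIcc_subset_Isub ha hq).trans (S.Isub_subset_dom _)
    have e : shiftSeq 1 ζ l = ζ (l + 1) := by rw [shiftSeq_apply, add_comm]
    exact add_le_add (abs_sub_le_of_mem_uIcc_of_injOn ((S.continuousOn_comp l _).mono hsub)
      ((S.injOn_comp l _).mono hsub) hc) (ih (e ▸ ha) (e ▸ hq))

lemma orbitDist_comm (l : ℕ) (ζ : ℕ → Fin p) (y z : ℝ) :
    S.orbitDist l ζ y z = S.orbitDist l ζ z y := by
  induction l generalizing ζ with
  | zero => rfl
  | succ l ih => rw [orbitDist_succ, orbitDist_succ, ih, abs_sub_comm]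

lemma orbitDist_eq_sum (l : ℕ) (ζ : ℕ → Fin p) (y z : ℝ) : S.orbitDist l ζ y z =
    ∑ k ∈ Finset.range l, |S.comp (l - (k + 1)) (shiftSeq (k + 1) ζ) y -
      S.comp (l - (k + 1)) (shiftSeq (k + 1) ζ) z| := by
  induction l generalizing ζ with
  | zero => rfl
  | succ l ih =>
    rw [Finset.sum_range_succ', orbitDist_succ, ih, add_comm]
    simp [shiftSeq_shiftSeq, add_comm 1]

/-- Gap intervals along left extensions of a nonperiodic sequence have bounded total length. -/
lemma orbitDist_le_of_isGap {η : ℕ → Fin p} {q : ℝ} (hgap : S.IsGap (recurrentSet ξ) η q)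
    (hper : ∀ P > 0, shiftSeq P η ≠ η) {l : ℕ} {ζ : ℕ → Fin p} (hζ : ζ ∈ recurrentSet ξ)
    (hl : shiftSeq l ζ = η) : S.orbitDist l ζ q (S.code η) ≤ 2 * diam S.I := by
  obtain ⟨u, v, huv, hI⟩ := S.hI
  rw [orbitDist_eq_sum, hI, Real.diam_Icc huv.le]
  have hsh : ∀ k ∈ Finset.range l, shiftSeq (l - (k + 1)) (shiftSeq (k + 1) ζ) = η := by
    intro k hk
    have := Finset.mem_range.1 hk
    rw [shiftSeq_shiftSeq, ← hl]
    congr 1; lia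
  refine sum_abs_sub_le_of_gaps _ _ _ huv.le
    (fun k _ => hI ▸ S.dom_subset_I (S.comp_mem_dom _ _ (S.code_mem_dom η)))
    (fun k _ => hI ▸ S.dom_subset_I (S.comp_mem_dom _ _ (S.Isub_subset_dom _ hgap.1)))
    fun i hi j hj hij => ?_
  have hgi : S.IsGap (recurrentSet ξ) (shiftSeq (i + 1) ζ)
      (S.comp (l - (i + 1)) (shiftSeq (i + 1) ζ) q) :=
    IsGap.of_shiftSeq (by rwa [hsh i hi])
  have hci := S.code_eq_comp (l - (i + 1)) (shiftSeq (i + 1) ζ)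
  have hcj := S.code_eq_comp (l - (j + 1)) (shiftSeq (j + 1) ζ)
  rw [hsh i hi] at hci
  rw [hsh j hj] at hcj
  rw [← hci, ← hcj] at hij
  have heq := S.code_injective (hgi.2.2 _ (shiftSeq_mem_recurrentSet hζ _) hij)
  clear hij hgi hci hcj
  by_contra hne
  wlog hlt : i < j generalizing i j
  · exact this j hj i hi heq.symm (Ne.symm hne) (by lia)
  have hj' := Finset.mem_range.1 hj
  refine hper (j - i) (by lia) ?_
  conv_lhs => rw [← hsh j hj, heq, shiftSeq_shiftSeq, shiftSeq_shiftSeq]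
  rw [← hl]
  congr 1; lia

/-- Points close to the code of `η` stay trapped by the gap intervals along left extensions. -/
lemma exists_trapped {η : ℕ → Fin p} {q : ℝ} (hgap : S.IsGap (recurrentSet ξ) η q)
    (hper : ∀ P > 0, shiftSeq P η ≠ η) : ∃ δ > 0, ∀ l, ∀ ζ ∈ recurrentSet ξ, shiftSeq l ζ = η →
      ∀ y ∈ S.Isub (η 0), |y - S.code η| ≤ δ →
        |S.comp l ζ y - S.code ζ| ≤ |S.comp l ζ q - S.code ζ| := by
  set E := Real.exp (S.lipConst * (2 * diam S.I)) with hE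
  have hE0 : 0 < E := Real.exp_pos _
  have hE1 : 1 ≤ E := Real.one_le_exp
    (mul_nonneg S.lipConst_nonneg (by linarith [S.diam_I_pos]))
  have hq0 : 0 < |q - S.code η| := abs_pos.2 (sub_ne_zero.2 hgap.2.1)
  have ha := S.code_mem_Isub η
  have had := S.code_mem_dom η
  refine ⟨|q - S.code η| / (E * E), by positivity, ?_⟩
  suffices H : ∀ l, ∀ ζ ∈ recurrentSet ξ, shiftSeq l ζ = η → ∀ y ∈ S.Isub (η 0),
      |y - S.code η| ≤ |q - S.code η| / (E * E) →
        S.orbitDist l ζ y (S.code η) ≤ S.orbitDist l ζ q (S.code η) ∧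
        |S.comp l ζ y - S.code ζ| ≤ |S.comp l ζ q - S.code ζ| from
    fun l ζ hζ hl y hy hyδ => (H l ζ hζ hl y hy hyδ).2
  intro l
  induction l with
  | zero =>
    intro ζ _ hl y _ hyδ
    rw [shiftSeq_zero] at hl
    subst hl
    refine ⟨le_rfl, hyδ.trans (div_le_self hq0.le ?_)⟩
    nlinarith
  | succ l ih =>
    intro ζ hζ hl
    have hl' : shiftSeq l (shiftSeq 1 ζ) = η := by rw [shiftSeq_shiftSeq, add_comm, hl]
    have hηl : ζ (l + 1) = η 0 := by rw [← hl]; rfl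
    have hdist : ∀ y ∈ S.Isub (η 0), |y - S.code η| ≤ |q - S.code η| / (E * E) →
        S.orbitDist (l + 1) ζ y (S.code η) ≤ S.orbitDist (l + 1) ζ q (S.code η) := by
      intro y hy hyδ
      obtain ⟨h1, h2⟩ := ih _ (shiftSeq_mem_recurrentSet hζ 1) hl' y hy hyδ
      have hc := S.code_eq_comp l (shiftSeq 1 ζ)
      rw [hl'] at hc
      rw [orbitDist_succ, orbitDist_succ, ← hc]
      exact add_le_add h2 h1
    have hbound := S.orbitDist_le_of_isGap hgap hper hζ hl
    intro y hy hyδ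
    refine ⟨hdist y hy hyδ, ?_⟩
    have hc := S.code_eq_comp (l + 1) ζ
    rw [hl] at hc
    obtain ⟨c, hcm, hc1⟩ := S.exists_abs_comp_sub_eq (l + 1) ζ hy ha
    obtain ⟨d, hdm, hd1⟩ := S.exists_abs_comp_sub_eq (l + 1) ζ hgap.1 ha
    have hcI := S.uIcc_subset_Isub hy ha hcm
    have hdI := S.uIcc_subset_Isub hgap.1 ha hdm
    have hcδ : |c - S.code η| ≤ |q - S.code η| / (E * E) := by
      rw [uIcc_comm] at hcm
      exact (abs_sub_left_of_mem_uIcc hcm).trans hyδ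
    have h1 := S.abs_compDer_le_exp_mul (l + 1) ζ (S.Isub_subset_dom _ hcI) had
      ((hdist c hcI hcδ).trans hbound)
    have h2 := S.abs_compDer_le_exp_mul (l + 1) ζ had (S.Isub_subset_dom _ hdI)
      (D := 2 * diam S.I) (by
        rw [orbitDist_comm]
        rw [uIcc_comm] at hdm
        exact (S.orbitDist_mono (hηl ▸ ha) (hηl ▸ hgap.1) hdm).trans hbound)
    rw [hc, hc1, hd1]
    calc |S.compDer (l + 1) ζ c| * |y - S.code η|
        ≤ E * (E * |S.compDer (l + 1) ζ d|) * (|q - S.code η| / (E * E)) := by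
          gcongr
          exact h1.trans (mul_le_mul_of_nonneg_left h2 hE0.le)
      _ = |S.compDer (l + 1) ζ d| * |q - S.code η| := by field_simp

/-- Along a sequence which is not eventually periodic, the sums of lengths are bounded along a
subsequence. -/
lemma exists_frequently_lenSum_le (hξ : ¬ ∃ P > 0, ∃ T, ∀ n ≥ T, ξ (n + P) = ξ n) :
    ∃ K, ∀ N, ∃ n ≥ N, S.lenSum ξ n ≤ K := by
  obtain ⟨η, hη, q, hgap, hper⟩ := S.exists_isGap_not_periodic hξ
  obtain ⟨δ, hδ, htrap⟩ := S.exists_trapped hgap hper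
  obtain ⟨m, hm⟩ := S.exists_len_lt hδ
  have hcyl : ∀ l, ∀ ζ ∈ recurrentSet ξ, shiftSeq l ζ = η →
      S.len ζ (l + m) ≤ 2 * |S.comp l ζ q - S.code ζ| := by
    intro l ζ hζ hl
    refine diam_le_of_forall_dist_le (by positivity) ?_
    have h : ∀ x ∈ S.cylinder ζ (l + m), |x - S.code ζ| ≤ |S.comp l ζ q - S.code ζ| := by
      rintro _ ⟨w, hw, rfl⟩
      have hw' : S.comp m η w ∈ S.cylinder η m := ⟨w, by rwa [← hl, shiftSeq_apply], rfl⟩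
      rw [comp_add, hl]
      exact htrap l ζ hζ hl _ (S.cylinder_subset_Isub _ _ hw')
        ((S.abs_sub_le_len hw' (S.code_mem_cylinder η m)).trans (hm η m le_rfl).le)
    intro x hx y hy
    refine (dist_triangle_right x y (S.code ζ)).trans ?_
    rw [Real.dist_eq, Real.dist_eq]
    linarith [h x hx, h y hy]
  have hsum : ∀ l, ∀ ζ ∈ recurrentSet ξ, shiftSeq l ζ = η → S.lenSum ζ (l + m) ≤
      2 * (|S.comp l ζ q - S.code ζ| + S.orbitDist l ζ q (S.code η)) + S.lenSum η m := by
    intro l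
    induction l with
    | zero =>
      intro ζ _ hl
      rw [shiftSeq_zero] at hl
      subst hl
      have := abs_nonneg (S.comp 0 ζ q - S.code ζ)
      simp only [zero_add, orbitDist]
      linarith
    | succ l ih =>
      intro ζ hζ hl
      have hl' : shiftSeq l (shiftSeq 1 ζ) = η := by rw [shiftSeq_shiftSeq, add_comm, hl]
      have h1 := ih _ (shiftSeq_mem_recurrentSet hζ 1) hl'
      have h2 := hcyl (l + 1) ζ hζ hl
      have hc := S.code_eq_comp l (shiftSeq 1 ζ)
      rw [hl'] at hc
      rw [Nat.add_right_comm] at h2 ⊢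
      rw [lenSum_succ, orbitDist_succ, ← hc]
      linarith
  refine ⟨diam S.I + (6 * diam S.I + S.lenSum η m), fun N => ?_⟩
  obtain ⟨ζ, hζ, hN⟩ := exists_shiftSeq_eq hη N
  have hocc : ∃ k, ∀ j ≤ N + m, ξ (k + j) = ζ j := by
    obtain ⟨k, -, h⟩ := hζ (N + m) 0
    exact ⟨k, h⟩
  refine ⟨Nat.find hocc + (N + m), by lia, (S.lenSum_first_occurrence_le (Nat.find_spec hocc)
    fun k' hk' => Nat.find_min hocc hk').trans ?_⟩
  have h1 := hsum N ζ hζ hN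
  have h2 := S.orbitDist_le_of_isGap hgap hper hζ hN
  have h3 := S.abs_sub_le_diam_I (S.comp_mem_dom N ζ (S.Isub_subset_dom _ hgap.1))
    (S.code_mem_dom ζ)
  linarith

end ExpansiveMarkovSystem

section Avoids

variable {p : ℕ} {Q : Finset (List (Fin p))}

lemma avoids.shiftSeq {ξ : ℕ → Fin p} (h : avoids Q ξ) (n : ℕ) : avoids Q (shiftSeq n ξ) :=
  fun w hw m hm => h w hw (n + m) fun k hk => by rw [add_assoc]; exact hm k hk

lemma avoids_consSeq_of_agree {i : Fin p} {ζ η : ℕ → Fin p} (hζ : avoids Q (consSeq i ζ))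
    (hη : avoids Q η) (h : ∀ j < Q.sup List.length, η j = ζ j) : avoids Q (consSeq i η) := by
  intro w hw n hn
  cases n with
  | zero =>
    refine hζ w hw 0 fun k hk => ?_
    rw [← hn k hk]
    have hk' : k < Q.sup List.length := hk.trans_le (Finset.le_sup (f := List.length) hw)
    rw [zero_add]
    cases k with
    | zero => rfl
    | succ k => rw [consSeq_succ, consSeq_succ, h k (by lia)]
  | succ n =>
    refine hη w hw n fun k hk => ?_
    rw [← hn k hk, Nat.add_right_comm, consSeq_succ]

lemma isClosed_avoids (Q : Finset (List (Fin p))) : IsClosed {ξ | avoids Q ξ} := by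
  refine isClosed_of_closure_subset fun ξ hξ w hw n hn => ?_
  obtain ⟨η, h, hη⟩ := mem_closure_iff_nhds.1 hξ _
    (ExpansiveMarkovSystem.eventually_agree ξ (n + w.length))
  exact hη w hw n fun k hk => by rw [← h _ (by lia), hn k hk]

lemma exists_avoids_glue {ζ : ℕ → Fin p} (hζ : avoids Q ζ) {N : ℕ} (hN : Q.sup List.length ≤ N)
    (n : ℕ) {η : ℕ → Fin p} (hη : avoids Q η) (h : ∀ j < N, η (n + j) = ζ j) :
    ∃ ω, avoids Q ω ∧ shiftSeq n ω = ζ ∧ ∀ k < n + N, ω k = η k := by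
  induction n generalizing η with
  | zero => exact ⟨ζ, hζ, by simp, fun k hk => by rw [← h k (by lia), zero_add]⟩
  | succ n ih =>
    obtain ⟨ω, hω, hωζ, hωη⟩ := ih (hη.shiftSeq 1) fun j hj => by
      rw [shiftSeq_apply, ← h j hj]; congr 1; lia
    refine ⟨consSeq (η 0) ω, avoids_consSeq_of_agree (ζ := shiftSeq 1 η) ?_ hω
      fun j hj => hωη j (by lia), ?_, fun k hk => ?_⟩
    · rwa [consSeq_head_shiftSeq]
    · rw [add_comm n 1, ← shiftSeq_shiftSeq, shiftSeq_one_consSeq, hωζ]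
    · cases k with
      | zero => rfl
      | succ k => rw [consSeq_succ, hωη k (by lia), shiftSeq_apply, add_comm]

lemma countable_eventually_periodic (p : ℕ) :
    {ξ : ℕ → Fin p | ∃ P > 0, ∃ T, ∀ n ≥ T, ξ (n + P) = ξ n}.Countable := by
  have h : ∀ P T : ℕ, 0 < P →
      {ξ : ℕ → Fin p | ∀ n ≥ T, ξ (n + P) = ξ n}.Countable := by
    intro P T hP
    refine MapsTo.countable_of_injOn (f := fun (ξ : ℕ → Fin p) (i : Fin (T + P)) => ξ i)
      (mapsTo_univ _ _) (fun ξ hξ η hη heq => ?_) countable_univ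
    funext n
    induction n using Nat.strong_induction_on with
    | _ n ih =>
      by_cases hn : n < T + P
      · exact congrFun heq ⟨n, hn⟩
      · obtain ⟨m, rfl⟩ : ∃ m, n = m + P := ⟨n - P, by lia⟩
        rw [hξ m (by lia), hη m (by lia), ih m (by lia)]
  refine (countable_iUnion fun P => countable_iUnion fun T =>
    countable_iUnion fun hP : 0 < P => h P T hP).mono ?_
  rintro ξ ⟨P, hP, T, hT⟩
  simp only [mem_iUnion]
  exact ⟨P, T, hP, hT⟩

end Avoids

namespace ExpansiveMarkovSystem

variable {p : ℕ} (S : ExpansiveMarkovSystem p)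

lemma isClosedEmbedding_code : Topology.IsClosedEmbedding S.code :=
  S.continuous_code.isClosedEmbedding S.code_injective

lemma isCompact_limitSet : IsCompact S.limitSet := by
  rw [limitSet_eq]
  exact (isClosed_avoids S.Q).isCompact.image S.continuous_code

lemma isOpen_agree (ξ : ℕ → Fin p) (n : ℕ) : IsOpen {η : ℕ → Fin p | ∀ k ≤ n, ξ k = η k} :=
  isOpen_iff_mem_nhds.2 fun η hη => by
    filter_upwards [eventually_agree η n] with ζ hζ k hk
    exact (hη k hk).trans (hζ k hk)

lemma isClosed_agree (ξ : ℕ → Fin p) (n : ℕ) : IsClosed {η : ℕ → Fin p | ∀ k ≤ n, ξ k = η k} := by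
  simp only [ofPred_forall]
  exact isClosed_iInter fun k => isClosed_iInter fun _ =>
    isClosed_eq continuous_const (continuous_apply k)

/-- Symbolic form of topological transitivity. -/
lemma exists_shiftSeq_eq_of_avoids {ξ ζ : ℕ → Fin p} (hξ : avoids S.Q ξ) (hζ : avoids S.Q ζ)
    (N : ℕ) : ∃ n ω, avoids S.Q ω ∧ shiftSeq n ω = ζ ∧ ∀ k ≤ N, ξ k = ω k := by
  set M := max (S.Q.sup List.length) N with hM
  have key : ∀ ξ : ℕ → Fin p, ∃ U : Set ℝ, IsOpen U ∧
      S.code ⁻¹' U = {η : ℕ → Fin p | ∀ k ≤ M, ξ k = η k} := fun ξ =>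
    S.isClosedEmbedding_code.isInducing.isOpen_iff.1 (isOpen_agree ξ M)
  obtain ⟨U, hU, hU'⟩ := key ξ
  obtain ⟨V, hV, hV'⟩ := key ζ
  have hmem : ∀ ξ : ℕ → Fin p, avoids S.Q ξ → S.code ξ ∈ S.limitSet := fun ξ hξ => by
    rw [limitSet_eq]; exact ⟨ξ, hξ, rfl⟩
  obtain ⟨n, x, ⟨hxU, hx⟩, hxV⟩ := S.htrans U V hU hV
    ⟨S.code ξ, by
      rw [← mem_preimage, hU']; exact fun _ _ => rfl, hmem ξ hξ⟩
    ⟨S.code ζ, by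
      rw [← mem_preimage, hV']; exact fun _ _ => rfl, hmem ζ hζ⟩
  change x ∈ S.limitSet at hx
  rw [limitSet_eq] at hx
  obtain ⟨η, hη, rfl⟩ := hx
  rw [iterate_f_code, ← mem_preimage, hV'] at hxV
  rw [← mem_preimage, hU'] at hxU
  obtain ⟨ω, hω, hωζ, hωη⟩ := exists_avoids_glue hζ (N := M + 1) (by lia) n hη
    fun j hj => (hxV j (by lia)).symm
  exact ⟨n, ω, hω, hωζ, fun k hk => by rw [hxU k (by lia), hωη k (by lia)]⟩

/-- The part of the limit set in a cylinder. -/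
def limitCylinder (ξ : ℕ → Fin p) (n : ℕ) : Set ℝ := S.limitSet ∩ S.cylinder ξ n

lemma code_mem_cylinder_iff {ξ η : ℕ → Fin p} {n : ℕ} :
    S.code η ∈ S.cylinder ξ n ↔ ∀ k ≤ n, ξ k = η k :=
  ⟨fun h k hk => S.eq_of_mem_cylinder h (S.code_mem_cylinder η n) k hk hk,
    fun h => S.cylinder_congr h ▸ S.code_mem_cylinder η n⟩

lemma limitCylinder_eq (ξ : ℕ → Fin p) (n : ℕ) : S.limitCylinder ξ n =
    S.code '' ({η | avoids S.Q η} ∩ {η | ∀ k ≤ n, ξ k = η k}) := by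
  rw [limitCylinder, limitSet_eq]
  ext x
  constructor
  · rintro ⟨⟨η, hη, rfl⟩, h⟩
    exact ⟨η, ⟨hη, S.code_mem_cylinder_iff.1 h⟩, rfl⟩
  · rintro ⟨η, ⟨hη, h⟩, rfl⟩
    exact ⟨⟨η, hη, rfl⟩, S.code_mem_cylinder_iff.2 h⟩

lemma measurableSet_limitCylinder (ξ : ℕ → Fin p) (n : ℕ) :
    MeasurableSet (S.limitCylinder ξ n) :=
  S.isCompact_limitSet.measurableSet.inter (S.isCompact_cylinder ξ n).measurableSet

lemma fder_code (ξ : ℕ → Fin p) :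
    S.fder (S.code ξ) = (S.gder (ξ 0) (S.code (shiftSeq 1 ξ)))⁻¹ := by
  rw [S.code_eq_g ξ]; exact S.hfder _ _ (S.code_mem_dom _)

lemma image_f_code (K : Set (ℕ → Fin p)) :
    S.f '' (S.code '' K) = S.code '' (shiftSeq 1 '' K) := by
  simp only [image_image, f_code]

lemma injOn_f_code {K : Set (ℕ → Fin p)} {i : Fin p} (hK : ∀ ξ ∈ K, ξ 0 = i) :
    InjOn S.f (S.code '' K) := by
  rintro _ ⟨ξ, hξ, rfl⟩ _ ⟨η, hη, rfl⟩ h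
  rw [f_code, f_code] at h
  rw [← consSeq_head_shiftSeq ξ, ← consSeq_head_shiftSeq η, S.code_injective h, hK ξ hξ, hK η hη]

lemma image_f_limitCylinder {ζ : ℕ → Fin p} (hζ : avoids S.Q ζ) {n : ℕ}
    (hn : S.Q.sup List.length ≤ n) :
    S.f '' S.limitCylinder ζ (n + 1) = S.limitCylinder (shiftSeq 1 ζ) n := by
  rw [limitCylinder_eq, limitCylinder_eq, image_f_code]
  congr 1
  ext η
  constructor
  · rintro ⟨ω, ⟨hω, h⟩, rfl⟩
    exact ⟨hω.shiftSeq 1, fun k hk => h _ (by lia)⟩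
  · rintro ⟨hη, h⟩
    refine ⟨consSeq (ζ 0) η, ⟨avoids_consSeq_of_agree (ζ := shiftSeq 1 ζ) ?_ hη
      fun j hj => (h j (by lia)).symm, fun k hk => ?_⟩, shiftSeq_one_consSeq _ _⟩
    · rwa [consSeq_head_shiftSeq]
    · cases k with
      | zero => rfl
      | succ k => rw [consSeq_succ, ← h k (by lia), shiftSeq_apply, add_comm]

section Conformal

variable {S} {ν : Measure ℝ} {t : ℝ}

lemma IsConformal.measure_image_le (hν : S.IsConformal ν t) (ht : 0 ≤ t) {A : Set ℝ}
    (hA : MeasurableSet A) (hAΛ : A ⊆ S.limitSet) (hinj : InjOn S.f A) {M : ℝ}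
    (hM : ∀ x ∈ A, |S.fder x| ≤ M) : ν (S.f '' A) ≤ ENNReal.ofReal (M ^ t) * ν A := by
  rw [hν.2.2 A hA hAΛ hinj, ← setLIntegral_const]
  exact setLIntegral_mono measurable_const fun x hx =>
    ENNReal.ofReal_le_ofReal (Real.rpow_le_rpow (abs_nonneg _) (hM x hx) ht)

lemma IsConformal.measure_shift_eq_zero (hν : S.IsConformal ν t) {K : Set (ℕ → Fin p)}
    (hK : IsCompact K) (hKQ : ∀ ξ ∈ K, avoids S.Q ξ) (h0 : ν (S.code '' K) = 0) :
    ν (S.code '' (shiftSeq 1 '' K)) = 0 := by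
  rw [← image_f_code, show K = ⋃ i, K ∩ {ξ | ξ 0 = i} by ext ξ; simp, image_iUnion, image_iUnion,
    measure_iUnion_null_iff]
  intro i
  have hcl : IsClosed {ξ : ℕ → Fin p | ξ 0 = i} :=
    isClosed_eq (continuous_apply 0) continuous_const
  rw [hν.2.2 _ ((hK.inter_right hcl).image S.continuous_code).measurableSet _
    (S.injOn_f_code fun ξ hξ => hξ.2)]
  · exact setLIntegral_measure_zero _ _
      (measure_mono_null (image_mono inter_subset_left) h0)
  · rw [limitSet_eq]
    exact image_mono fun ξ hξ => hKQ ξ hξ.1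

lemma continuous_shiftSeq (n : ℕ) : Continuous (shiftSeq (p := p) n) :=
  continuous_pi fun k => continuous_apply (n + k)

lemma IsConformal.measure_limitCylinder_pos (hν : S.IsConformal ν t) {ξ : ℕ → Fin p}
    (hξ : avoids S.Q ξ) (N : ℕ) : 0 < ν (S.limitCylinder ξ N) := by
  refine pos_iff_ne_zero.2 fun h0 => ?_
  rw [limitCylinder_eq] at h0
  set K := {η | avoids S.Q η} ∩ {η | ∀ k ≤ N, ξ k = η k} with hK
  have hKc : IsCompact K := ((isClosed_avoids S.Q).inter (isClosed_agree ξ N)).isCompact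
  have hn : ∀ n, ν (S.code '' (shiftSeq n '' K)) = 0 := by
    intro n
    induction n with
    | zero => simpa [show shiftSeq (p := p) 0 = id from funext shiftSeq_zero] using h0
    | succ n ih =>
      have := hν.measure_shift_eq_zero (hKc.image (continuous_shiftSeq n))
        (by rintro _ ⟨η, hη, rfl⟩; exact hη.1.shiftSeq n) ih
      rw [image_image (shiftSeq 1)] at this
      simpa only [shiftSeq_shiftSeq] using this
  have hcov : S.limitSet ⊆ ⋃ n, S.code '' (shiftSeq n '' K) := by
    rw [limitSet_eq]
    rintro _ ⟨ζ, hζ, rfl⟩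
    obtain ⟨n, ω, hω, rfl, h⟩ := S.exists_shiftSeq_eq_of_avoids hξ hζ N
    exact mem_iUnion.2 ⟨n, _, ⟨ω, ⟨hω, h⟩, rfl⟩, rfl⟩
  have hΛ : ν S.limitSet = 0 := measure_mono_null hcov (measure_iUnion_null hn)
  have := hν.1
  have h1 := measure_univ (μ := ν)
  rw [← union_compl_self S.limitSet, measure_union_null hΛ hν.2.1] at h1
  exact zero_ne_one h1

lemma limitCylinder_congr {ξ η : ℕ → Fin p} {n : ℕ} (h : ∀ k ≤ n, ξ k = η k) :
    S.limitCylinder ξ n = S.limitCylinder η n := by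
  rw [limitCylinder, limitCylinder, S.cylinder_congr h]

lemma IsConformal.exists_le_measure_limitCylinder (hν : S.IsConformal ν t) (N : ℕ) :
    ∃ c : ENNReal, c ≠ 0 ∧ c ≠ ⊤ ∧ ∀ ξ, avoids S.Q ξ → c ≤ ν (S.limitCylinder ξ N) := by
  have := hν.1
  set R := (fun ξ => ν (S.limitCylinder ξ N)) '' {ξ | avoids S.Q ξ} with hR
  have hfin : R.Finite := by
    refine (finite_range fun w : Fin (N + 1) → Fin p => ν (S.limitCylinder
      (fun k => if h : k < N + 1 then w ⟨k, h⟩ else ⟨0, S.hp⟩) N)).subset ?_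
    rintro _ ⟨ξ, -, rfl⟩
    refine ⟨fun k => ξ k, ?_⟩
    dsimp only
    rw [limitCylinder_congr fun k hk => ?_]
    simp [Nat.lt_succ_of_le hk]
  by_cases hne : R.Nonempty
  · obtain ⟨c, ⟨ξ, hξ, rfl⟩, hmin⟩ := exists_min_image R id hfin hne
    exact ⟨_, (hν.measure_limitCylinder_pos hξ N).ne', measure_ne_top _ _,
      fun η hη => hmin _ ⟨η, hη, rfl⟩⟩
  · refine ⟨1, one_ne_zero, ENNReal.one_ne_top, fun ξ hξ => absurd ⟨_, ξ, hξ, rfl⟩ hne⟩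

/-- Lower bound for the measure of a cylinder in terms of the derivative. -/
lemma IsConformal.measure_limitCylinder_shift_le (hν : S.IsConformal ν t) (ht : 0 ≤ t) {ℓ : ℕ}
    (hℓ : S.Q.sup List.length ≤ ℓ) (n : ℕ) {ζ : ℕ → Fin p} (hζ : avoids S.Q ζ) :
    ν (S.limitCylinder (shiftSeq n ζ) ℓ) ≤
      ENNReal.ofReal ((Real.exp (S.lipConst * (S.lenSum ζ n - S.len ζ n)) /
        |S.compDer n ζ (S.code (shiftSeq n ζ))|) ^ t) * ν (S.limitCylinder ζ (n + ℓ)) := by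
  induction n generalizing ζ with
  | zero => simp [lenSum_zero]
  | succ n ih =>
    have h1 := ih (hζ.shiftSeq 1)
    rw [shiftSeq_shiftSeq, add_comm 1 n] at h1
    have hc := S.code_eq_comp n (shiftSeq 1 ζ)
    rw [shiftSeq_shiftSeq, add_comm 1 n] at hc
    have h2 : ν (S.limitCylinder (shiftSeq 1 ζ) (n + ℓ)) ≤
        ENNReal.ofReal ((Real.exp (S.lipConst * S.len (shiftSeq 1 ζ) n) /
          |S.gder (ζ 0) (S.code (shiftSeq 1 ζ))|) ^ t) * ν (S.limitCylinder ζ (n + ℓ + 1)) := by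
      rw [← S.image_f_limitCylinder hζ (by lia)]
      have hinj : InjOn S.f (S.limitCylinder ζ (n + ℓ + 1)) := by
        rw [limitCylinder_eq]
        exact S.injOn_f_code fun ξ hξ => (hξ.2 0 (by lia)).symm
      refine hν.measure_image_le ht (S.measurableSet_limitCylinder _ _) inter_subset_left hinj ?_
      rw [limitCylinder_eq]
      rintro _ ⟨ω, ⟨-, hω⟩, rfl⟩
      have hpos := S.abs_gder_pos (ζ 0) (S.code_mem_dom (shiftSeq 1 ζ))
      have hpos' := S.abs_gder_pos (ζ 0) (S.code_mem_dom (shiftSeq 1 ω))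
      have hle := (le_abs_self _).trans (S.abs_log_gder_sub_le (ζ 0)
        (S.code_mem_dom (shiftSeq 1 ζ)) (S.code_mem_dom (shiftSeq 1 ω)))
      have hlen : |S.code (shiftSeq 1 ζ) - S.code (shiftSeq 1 ω)| ≤ S.len (shiftSeq 1 ζ) n :=
        S.abs_code_sub_le fun k hk => hω _ (by lia)
      have hle' := hle.trans (mul_le_mul_of_nonneg_left hlen S.lipConst_nonneg)
      rw [fder_code, ← hω 0 (by lia), abs_inv, le_div_iff₀ hpos, inv_mul_le_iff₀ hpos',
        ← Real.exp_log hpos, ← Real.exp_log hpos', ← Real.exp_add]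
      exact Real.exp_le_exp.2 (by linarith)
    refine h1.trans ((mul_le_mul_right h2 _).trans_eq ?_)
    rw [← mul_assoc, ← ENNReal.ofReal_mul (by positivity),
      ← Real.mul_rpow (by positivity) (by positivity), div_mul_div_comm, ← Real.exp_add,
      compDer_succ, ← hc, abs_mul, lenSum_succ, Nat.add_right_comm n ℓ 1, mul_comm |S.gder _ _|]
    congr 6
    ring

lemma IsConformal.mul_len_rpow_le (hν : S.IsConformal ν t) (ht : 0 ≤ t) {ℓ : ℕ}
    (hℓ : S.Q.sup List.length ≤ ℓ) {c : ENNReal}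
    (hc : ∀ ξ, avoids S.Q ξ → c ≤ ν (S.limitCylinder ξ ℓ)) {K : ℝ} {n : ℕ} {ζ : ℕ → Fin p}
    (hζ : avoids S.Q ζ) (hK : S.lenSum ζ n ≤ K) :
    ENNReal.ofReal (S.len ζ n ^ t) * c ≤
      ENNReal.ofReal ((Real.exp (2 * S.lipConst * K) * diam S.I) ^ t) * ν (S.cylinder ζ n) := by
  have h1 := (hc _ (hζ.shiftSeq n)).trans (hν.measure_limitCylinder_shift_le ht hℓ n hζ)
  have hsub : S.limitCylinder ζ (n + ℓ) ⊆ S.cylinder ζ n :=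
    inter_subset_right.trans (S.antitone_cylinder ζ (by lia))
  have hmem : S.code (shiftSeq n ζ) ∈ S.Isub (ζ n) := by
    simpa using S.code_mem_Isub (shiftSeq n ζ)
  have h2 := S.len_le_exp_mul hmem hK
  have hpos := S.abs_compDer_pos n ζ (S.code_mem_dom (shiftSeq n ζ))
  calc ENNReal.ofReal (S.len ζ n ^ t) * c
      ≤ ENNReal.ofReal (S.len ζ n ^ t) * (ENNReal.ofReal ((Real.exp (S.lipConst *
        (S.lenSum ζ n - S.len ζ n)) / |S.compDer n ζ (S.code (shiftSeq n ζ))|) ^ t) *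
          ν (S.cylinder ζ n)) := by
        gcongr
        exact h1.trans (by gcongr)
    _ ≤ _ := by
      rw [← mul_assoc, ← ENNReal.ofReal_mul (Real.rpow_nonneg (S.len_nonneg _ _) _),
        ← Real.mul_rpow (S.len_nonneg _ _) (by positivity)]
      refine mul_le_mul' (ENNReal.ofReal_le_ofReal (Real.rpow_le_rpow
        (mul_nonneg (S.len_nonneg _ _) (by positivity)) ?_ ht)) le_rfl
      have h3 : Real.exp (S.lipConst * (S.lenSum ζ n - S.len ζ n)) ≤
          Real.exp (S.lipConst * K) := Real.exp_le_exp.2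
        (mul_le_mul_of_nonneg_left (by linarith [S.len_nonneg ζ n]) S.lipConst_nonneg)
      calc _ ≤ (Real.exp (S.lipConst * K) * |S.compDer n ζ (S.code (shiftSeq n ζ))| *
            diam S.I) * (Real.exp (S.lipConst * K) /
              |S.compDer n ζ (S.code (shiftSeq n ζ))|) :=
            mul_le_mul h2 (by gcongr) (by positivity) ((S.len_nonneg _ _).trans h2)
        _ = Real.exp (S.lipConst * K) * Real.exp (S.lipConst * K) * diam S.I := by
            field_simp
        _ = _ := by rw [← Real.exp_add]; ring_nf

lemma ediam_cylinder (ξ : ℕ → Fin p) (n : ℕ) :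
    ediam (S.cylinder ξ n) = ENNReal.ofReal (S.len ξ n) :=
  (ENNReal.ofReal_toReal (S.isCompact_cylinder ξ n).isBounded.ediam_ne_top).symm

/-- The points with infinitely many indices at which the sum of lengths is at most `K` form a set
of dimension at most `t`. -/
lemma IsConformal.dimH_le_of_frequently (hν : S.IsConformal ν t) (ht : 0 ≤ t) (K : ℝ) :
    dimH (S.code '' {ξ | avoids S.Q ξ ∧ ∀ N, ∃ n ≥ N, S.lenSum ξ n ≤ K}) ≤ ENNReal.ofReal t := by
  set G := {ξ | avoids S.Q ξ ∧ ∀ N, ∃ n ≥ N, S.lenSum ξ n ≤ K} with hG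
  have := hν.1
  obtain ⟨c, hc0, hctop, hc⟩ := hν.exists_le_measure_limitCylinder (S.Q.sup List.length)
  have hlen : ∀ j : ℕ, ∃ N, ∀ ξ : ℕ → Fin p, ∀ n ≥ N, S.len ξ n < 1 / (j + 1 : ℝ) := fun j =>
    S.exists_len_lt (by positivity)
  choose N hN using hlen
  have hfind : ∀ j, ∀ ξ ∈ G, ∃ n, N j ≤ n ∧ S.lenSum ξ n ≤ K ∧
      ∀ m, N j ≤ m → S.lenSum ξ m ≤ K → n ≤ m := by
    intro j ξ hξ
    have h : ∃ n, N j ≤ n ∧ S.lenSum ξ n ≤ K := hξ.2 (N j)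
    exact ⟨Nat.find h, (Nat.find_spec h).1, (Nat.find_spec h).2,
      fun m hm hm' => Nat.find_min' h ⟨hm, hm'⟩⟩
  set F : ℕ → Set (Set ℝ) := fun j => {A | ∃ ξ ∈ G, ∃ n, N j ≤ n ∧ S.lenSum ξ n ≤ K ∧
    (∀ m, N j ≤ m → S.lenSum ξ m ≤ K → n ≤ m) ∧ A = S.cylinder ξ n} with hF
  have hcount : ∀ j, Countable (F j) := fun j => by
    refine ((countable_range S.cyl).mono ?_).to_subtype
    rintro _ ⟨ξ, -, n, -, -, -, rfl⟩
    rw [cylinder_eq_cyl]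
    exact mem_range_self _
  have hdisj : ∀ j, Pairwise (Function.onFun Disjoint fun A : F j => (A : Set ℝ)) := by
    intro j A B hne
    refine disjoint_left.2 fun x hx hx' => hne (Subtype.ext ?_)
    obtain ⟨ξ, -, n, hn, hnK, hmin, hA⟩ := A.2
    obtain ⟨η, -, m, hm, hmK, hmin', hB⟩ := B.2
    dsimp only at hx hx'
    rw [hA] at hx ⊢
    rw [hB] at hx' ⊢
    have hag := S.eq_of_mem_cylinder hx hx'
    rcases le_total n m with h | h
    · have := hmin' n hn (by rwa [← S.lenSum_congr fun k hk => hag k hk (hk.trans h)])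
      obtain rfl := le_antisymm h this
      exact S.cylinder_congr fun k hk => hag k hk hk
    · have := hmin m hm (by rwa [S.lenSum_congr fun k hk => hag k (hk.trans h) hk])
      obtain rfl := le_antisymm h this
      exact S.cylinder_congr fun k hk => hag k hk hk
  set M := ENNReal.ofReal ((Real.exp (2 * S.lipConst * K) * diam S.I) ^ t) with hM
  have hsum : ∀ j, ∑' A : F j, ediam (A : Set ℝ) ^ t ≤ M / c := by
    intro j
    rw [ENNReal.le_div_iff_mul_le (Or.inl hc0) (Or.inl hctop), ← ENNReal.tsum_mul_right]
    calc ∑' A : F j, ediam (A : Set ℝ) ^ t * c ≤ ∑' A : F j, M * ν (A : Set ℝ) := by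
          refine ENNReal.tsum_le_tsum ?_
          rintro ⟨_, ξ, hξ, n, -, hn, -, rfl⟩
          dsimp only
          rw [ediam_cylinder, ENNReal.ofReal_rpow_of_nonneg (S.len_nonneg _ _) ht]
          exact hν.mul_len_rpow_le ht le_rfl hc hξ.1 hn
      _ = M * ∑' A : F j, ν (A : Set ℝ) := ENNReal.tsum_mul_left
      _ ≤ M * 1 := by
          gcongr
          refine (tsum_meas_le_meas_iUnion_of_disjoint ν ?_ (hdisj j)).trans prob_le_one
          rintro ⟨_, ξ, -, n, -, -, -, rfl⟩
          exact (S.isCompact_cylinder ξ n).measurableSet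
      _ = M := mul_one _
  have hH : Measure.hausdorffMeasure t (S.code '' G) ≤ M / c := by
    refine (Measure.hausdorffMeasure_le_liminf_tsum (l := atTop) t (S.code '' G)
      (fun j : ℕ => ENNReal.ofReal (1 / (j + 1 : ℝ))) ?_
      (fun j (A : F j) => (A : Set ℝ)) ?_ ?_).trans
        ((liminf_le_liminf (Eventually.of_forall hsum)).trans_eq (liminf_const _))
    · rw [← ENNReal.ofReal_zero]
      exact ENNReal.tendsto_ofReal tendsto_one_div_add_atTop_nhds_zero_nat
    · refine Eventually.of_forall fun j => ?_
      rintro ⟨_, ξ, -, n, hn, -, -, rfl⟩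
      dsimp only
      rw [ediam_cylinder]
      exact ENNReal.ofReal_le_ofReal (hN j ξ n hn).le
    · refine Eventually.of_forall fun j => ?_
      rintro _ ⟨ξ, hξ, rfl⟩
      obtain ⟨n, h1, h2, h3⟩ := hfind j ξ hξ
      exact mem_iUnion.2 ⟨⟨_, ξ, hξ, n, h1, h2, h3, rfl⟩, S.code_mem_cylinder ξ n⟩
  have hd := dimH_le_of_hausdorffMeasure_ne_top (d := t.toNNReal) (s := S.code '' G) (by
    rw [Real.coe_toNNReal t ht]
    exact (hH.trans_lt (ENNReal.div_lt_top ENNReal.ofReal_ne_top hc0)).ne)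
  exact hd

/-- The exponent of a conformal measure bounds the dimension of the limit set. -/
theorem IsConformal.dimH_limitSet_le (hν : S.IsConformal ν t) (ht : 0 ≤ t) :
    dimH S.limitSet ≤ ENNReal.ofReal t := by
  set P := {ξ : ℕ → Fin p | ∃ P > 0, ∃ T, ∀ n ≥ T, ξ (n + P) = ξ n} with hP
  have hcov : S.limitSet ⊆ S.code '' P ∪ ⋃ K : ℕ,
      S.code '' {ξ | avoids S.Q ξ ∧ ∀ N, ∃ n ≥ N, S.lenSum ξ n ≤ K} := by
    rw [limitSet_eq]
    rintro _ ⟨ξ, hξ, rfl⟩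
    by_cases h : ξ ∈ P
    · exact Or.inl ⟨ξ, h, rfl⟩
    · obtain ⟨K, hK⟩ := S.exists_frequently_lenSum_le h
      obtain ⟨k, hk⟩ := exists_nat_ge K
      refine Or.inr (mem_iUnion.2 ⟨k, ξ, ⟨hξ, fun N => ?_⟩, rfl⟩)
      obtain ⟨n, hn, h'⟩ := hK N
      exact ⟨n, hn, h'.trans hk⟩
  refine (dimH_mono hcov).trans ?_
  rw [dimH_union, dimH_iUnion, ((countable_eventually_periodic p).image S.code).dimH_zero]
  exact max_le zero_le (iSup_le fun K => hν.dimH_le_of_frequently ht K)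

end Conformal

end ExpansiveMarkovSystem

/-- If all the tails of a nonnegative sequence are dominated by a multiple of their first term,
the sequence decays exponentially. -/
lemma le_geometric_of_tail_le {a : ℕ → ℝ} {D : ℝ} (hD : 1 ≤ D) (h0 : a 0 ≤ 1)
    (h : ∀ m N, ∑ k ∈ Finset.range N, a (m + k) ≤ D * a m) (m : ℕ) :
    a m ≤ D * (1 - 1 / D) ^ m := by
  have hD' : 0 < D := by linarith
  have hc : 0 ≤ 1 - 1 / D := by
    rw [sub_nonneg, div_le_one hD']; exact hD
  have key : ∀ m N, ∑ k ∈ Finset.range N, a (m + k) ≤ D * (1 - 1 / D) ^ m := by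
    intro m
    induction m with
    | zero => exact fun N => (h 0 N).trans (by rw [pow_zero]; gcongr)
    | succ m ih =>
      intro N
      have h1 := Finset.sum_range_succ' (fun k => a (m + k)) N
      have h2 : ∑ k ∈ Finset.range (N + 1), a (m + k) / D ≤ a m := by
        rw [← Finset.sum_div, div_le_iff₀ hD', mul_comm]
        exact h m (N + 1)
      rw [← Finset.sum_div] at h2
      have h3 : ∑ k ∈ Finset.range N, a (m + 1 + k) = ∑ k ∈ Finset.range N, a (m + (k + 1)) :=
        Finset.sum_congr rfl fun k _ => by rw [add_assoc, add_comm 1 k]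
      calc _ = ∑ k ∈ Finset.range (N + 1), a (m + k) - a m := by rw [h3, h1]; simp
        _ ≤ (1 - 1 / D) * ∑ k ∈ Finset.range (N + 1), a (m + k) := by
            rw [sub_mul, one_mul, one_div_mul_eq_div]; linarith
        _ ≤ (1 - 1 / D) * (D * (1 - 1 / D) ^ m) := by gcongr; exact ih _
        _ = _ := by ring
  simpa using key m 1

section PositiveOperator

variable {X : Type*} [TopologicalSpace X] {T : C(X, ℝ) →ₗ[ℝ] C(X, ℝ)}

lemma pow_nonneg_of_positive (hT : ∀ φ, 0 ≤ φ → 0 ≤ T φ) (n : ℕ) {φ : C(X, ℝ)} (hφ : 0 ≤ φ) :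
    0 ≤ (T ^ n) φ := by
  induction n with
  | zero => simpa
  | succ n ih => rw [pow_succ', Module.End.mul_apply]; exact hT _ ih

lemma pow_mono_of_positive (hT : ∀ φ, 0 ≤ φ → 0 ≤ T φ) (n : ℕ) {φ ψ : C(X, ℝ)} (h : φ ≤ ψ) :
    (T ^ n) φ ≤ (T ^ n) ψ := by
  have := pow_nonneg_of_positive hT n (sub_nonneg.2 h)
  rwa [map_sub, sub_nonneg] at this

lemma pow_apply_sub_eq_sum (h : C(X, ℝ)) (n : ℕ) :
    (T ^ n) h - h = ∑ k ∈ Finset.range n, (T ^ k) (T h - h) := by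
  induction n with
  | zero => simp
  | succ n ih =>
    rw [Finset.sum_range_succ, ← ih, map_sub, ← Module.End.mul_apply, ← pow_succ]
    abel

/-- A positive operator whose iterates grow subexponentially and do not decay exponentially admits
no function which it increases everywhere. -/
lemma not_forall_lt_of_growth [CompactSpace X] [Nonempty X] (hT : ∀ φ, 0 ≤ φ → 0 ≤ T φ)
    (hgrow : ∀ ε > 0, ∃ C : ℝ, ∀ (n : ℕ) x, (T ^ n) 1 x ≤ C * Real.exp (ε * n))
    (hdecay : ∀ C c : ℝ, 0 ≤ c → c < 1 → ∃ (n : ℕ) (x : X), C * c ^ n < (T ^ n) 1 x) (h : C(X, ℝ)) :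
    ∃ x, T h x ≤ h x := by
  by_contra! hlt
  obtain ⟨x₀, hx₀⟩ := (isCompact_univ (X := X)).exists_isMinOn univ_nonempty
    (T h - h).continuous.continuousOn
  set ε := (T h - h) x₀ with hε
  have hε0 : 0 < ε := by simpa [hε] using hlt x₀
  set C := ‖h‖ + 1 with hC
  have hC0 : 0 < C := by positivity
  have hhC : ∀ x, |h x| ≤ C := fun x => (h.norm_coe_le_norm x).trans (by simp [hC])
  have hle : (ε • 1 : C(X, ℝ)) ≤ T h - h := fun x => by
    simpa using show ε ≤ (T h - h) x from hx₀.2 (mem_univ x)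
  have hle' : h ≤ (C • 1 : C(X, ℝ)) := fun x => by simpa using (le_abs_self _).trans (hhC x)
  set a : X → ℕ → ℝ := fun x n => (T ^ n) 1 x with ha
  set δ := ε / C with hδ
  have hδ0 : 0 < δ := div_pos hε0 hC0
  have key : ∀ x n, δ * ∑ k ∈ Finset.range n, a x k - 1 ≤ a x n := by
    intro x n
    have h1 : ε * ∑ k ∈ Finset.range n, a x k ≤ ((T ^ n) h - h) x := by
      rw [pow_apply_sub_eq_sum, ContinuousMap.sum_apply, Finset.mul_sum]
      refine Finset.sum_le_sum fun k _ => ?_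
      simpa using pow_mono_of_positive hT k hle x
    have h2 : (T ^ n) h x ≤ C * a x n := by
      simpa using pow_mono_of_positive hT n hle' x
    have h3 := neg_le_of_abs_le (hhC x)
    rw [ContinuousMap.sub_apply] at h1
    have h4 : ε * ∑ k ∈ Finset.range n, a x k - C ≤ C * a x n := by linarith
    rw [hδ, ← mul_le_mul_iff_right₀ hC0]
    calc _ = ε * ∑ k ∈ Finset.range n, a x k - C := by field_simp
      _ ≤ _ := h4
  by_cases hbig : ∃ x n, 1 / δ < ∑ k ∈ Finset.range n, a x k
  · obtain ⟨x, n, hn⟩ := hbig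
    set s := ∑ k ∈ Finset.range n, a x k - 1 / δ with hs
    have hs0 : 0 < s := sub_pos.2 hn
    have hgr : ∀ k : ℕ, (1 + δ) ^ k * s ≤ ∑ j ∈ Finset.range (n + k), a x j - 1 / δ := by
      intro k
      induction k with
      | zero => simp [hs]
      | succ k ih =>
        rw [← add_assoc, Finset.sum_range_succ]
        have h1 := key x (n + k)
        have h2 : δ * (1 / δ) = 1 := by field_simp
        have h3 := mul_le_mul_of_nonneg_left ih (by linarith : 0 ≤ 1 + δ)
        rw [pow_succ', mul_assoc]
        linarith
    have hL : 0 < Real.log (1 + δ) := Real.log_pos (by linarith)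
    obtain ⟨M, hM⟩ := hgrow (Real.log (1 + δ) / 2) (by linarith)
    set L := Real.log (1 + δ) with hLdef
    have hb : ∀ k : ℕ, Real.exp (L / 2 * k) ≤ M * Real.exp (L / 2 * n) / (δ * s) := by
      intro k
      rw [le_div_iff₀ (mul_pos hδ0 hs0)]
      have h1 := key x (n + k)
      have h2 := hM (n + k) x
      have h3 := mul_le_mul_of_nonneg_left (hgr k) hδ0.le
      have h4 : δ * (1 / δ) = 1 := by field_simp
      have h5 : (1 + δ) ^ k = Real.exp (L / 2 * k) * Real.exp (L / 2 * k) := by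
        rw [← Real.exp_add, ← Real.exp_log (show 0 < 1 + δ by linarith), ← hLdef,
          ← Real.exp_nat_mul]
        ring_nf
      push_cast at h2
      rw [mul_add, Real.exp_add] at h2
      rw [h5] at h3
      refine le_of_mul_le_mul_right ?_ (Real.exp_pos (L / 2 * k))
      calc _ = δ * (Real.exp (L / 2 * k) * Real.exp (L / 2 * k) * s) := by ring
        _ ≤ M * (Real.exp (L / 2 * n) * Real.exp (L / 2 * k)) := by
          change a x (n + k) ≤ _ at h2
          linarith
        _ = _ := by ring
    have htop : Tendsto (fun k : ℕ => Real.exp (L / 2 * k)) atTop atTop :=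
      Real.tendsto_exp_atTop.comp (tendsto_natCast_atTop_atTop.const_mul_atTop (by linarith))
    obtain ⟨k, hk⟩ := (htop.eventually_gt_atTop (M * Real.exp (L / 2 * n) / (δ * s))).exists
    exact (hb k).not_gt hk
  · push Not at hbig
    set D := max (1 / δ) 1 with hD
    have hD1 : 1 ≤ D := le_max_right _ _
    have htail : ∀ x m N, ∑ k ∈ Finset.range N, a x (m + k) ≤ D * a x m := by
      intro x m N
      have h1 : ∑ k ∈ Finset.range N, (T ^ k) 1 ≤ (D • 1 : C(X, ℝ)) := fun y => by
        simpa [ContinuousMap.sum_apply] using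
          show ∑ k ∈ Finset.range N, a y k ≤ D from (hbig y N).trans (le_max_left _ _)
      have h2 := pow_mono_of_positive hT m h1 x
      simpa [map_sum, ContinuousMap.sum_apply, ← Module.End.mul_apply, ← pow_add] using h2
    obtain ⟨n, x, hn⟩ := hdecay D (1 - 1 / D)
      (by rw [sub_nonneg, div_le_one (by linarith)]; exact hD1) (sub_lt_self _ (by positivity))
    exact hn.not_ge (le_geometric_of_tail_le hD1 (by simp [ha]) (htail x) n)

/-- A positive operator whose iterates grow subexponentially and do not decay exponentially has
an invariant state. -/
lemma exists_invariant_state [CompactSpace X] [Nonempty X] (hT : ∀ φ, 0 ≤ φ → 0 ≤ T φ)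
    (hgrow : ∀ ε > 0, ∃ C : ℝ, ∀ (n : ℕ) x, (T ^ n) 1 x ≤ C * Real.exp (ε * n))
    (hdecay : ∀ C c : ℝ, 0 ≤ c → c < 1 → ∃ (n : ℕ) (x : X), C * c ^ n < (T ^ n) 1 x) :
    ∃ F : C(X, ℝ) →ₗ[ℝ] ℝ, (∀ φ, 0 ≤ φ → 0 ≤ F φ) ∧ F 1 = 1 ∧ ∀ φ, F (T φ) = F φ := by
  set s : Set C(X, ℝ) := {φ | ∀ x, 0 < φ x} with hs
  have hsc : Convex ℝ s := by
    intro φ hφ ψ hψ a b ha hb hab x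
    rcases ha.eq_or_lt with rfl | ha
    · simp_all
    · have := mul_pos ha (hφ x)
      have := mul_nonneg hb (hψ x).le
      simp only [ContinuousMap.add_apply, ContinuousMap.smul_apply, smul_eq_mul]
      linarith
  have hso : IsOpen s := by
    have := ContinuousMap.isOpen_setOfPred_mapsTo (X := X) (Y := ℝ) isCompact_univ
      (isOpen_Ioi (a := (0 : ℝ)))
    convert this using 1
    ext φ
    simp [hs, MapsTo]
  have hdisj : Disjoint s (LinearMap.range (T - LinearMap.id) : Set C(X, ℝ)) := by
    refine disjoint_left.2 ?_
    rintro _ hφ ⟨h, rfl⟩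
    obtain ⟨x, hx⟩ := not_forall_lt_of_growth hT hgrow hdecay h
    have := hφ x
    simp only [LinearMap.sub_apply, LinearMap.id_apply, ContinuousMap.sub_apply] at this
    linarith
  obtain ⟨f, u, hf, hu⟩ := geometric_hahn_banach_open hsc hso
    (Submodule.convex (LinearMap.range (T - LinearMap.id))) hdisj
  have hu0 : u ≤ 0 := by simpa using hu 0 (Submodule.zero_mem _)
  have hinv : ∀ φ, f (T φ) = f φ := by
    intro φ
    by_contra hne
    have hd : f (T φ) - f φ ≠ 0 := sub_ne_zero.2 hne
    have := hu (((u - 1) / (f (T φ) - f φ)) • (T φ - φ))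
      (Submodule.smul_mem _ _ ⟨φ, by simp⟩)
    rw [map_smul, map_sub, smul_eq_mul, div_mul_cancel₀ _ hd] at this
    linarith
  have hneg : ∀ φ ∈ s, f φ < 0 := fun φ hφ => (hf φ hφ).trans_le hu0
  have h1 : f 1 < 0 := hneg 1 fun x => by simp
  have hpos : ∀ φ, 0 ≤ φ → f φ ≤ 0 := by
    intro φ hφ
    by_contra! hlt
    have := hneg (φ + (f φ / (-f 1)) • 1) fun x => by
      have h2 : 0 ≤ φ x := hφ x
      have h3 : 0 < f φ / (-f 1) := div_pos hlt (by linarith)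
      simp only [ContinuousMap.add_apply, ContinuousMap.smul_apply, ContinuousMap.one_apply,
        smul_eq_mul, mul_one]
      linarith
    rw [map_add, map_smul, smul_eq_mul, div_mul_eq_mul_div, mul_div_assoc, div_neg,
      div_self h1.ne] at this
    linarith
  refine ⟨(f 1)⁻¹ • f.toLinearMap, fun φ hφ => ?_, ?_, fun φ => ?_⟩
  · simpa using mul_nonneg_of_nonpos_of_nonpos (inv_nonpos.2 h1.le) (hpos φ hφ)
  · simp [h1.ne]
  · simp [hinv]

end PositiveOperator

namespace ExpansiveMarkovSystem

variable {p : ℕ} (S : ExpansiveMarkovSystem p)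

section Ruelle

/-- The Ruelle operator of the potential `-t log |f'|` in symbolic coordinates. -/
noncomputable def ruelle (t : ℝ) (F : (ℕ → Fin p) → ℝ) (ξ : ℕ → Fin p) : ℝ :=
  ∑ i, if avoids S.Q (consSeq i ξ) then |S.gder i (S.code ξ)| ^ t * F (consSeq i ξ) else 0

variable {t : ℝ} {F G : (ℕ → Fin p) → ℝ}

lemma ruelle_mono (h : ∀ ξ, avoids S.Q ξ → F ξ ≤ G ξ) (ξ : ℕ → Fin p) :
    S.ruelle t F ξ ≤ S.ruelle t G ξ :=
  Finset.sum_le_sum fun i _ => by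
    split_ifs with hi
    · exact mul_le_mul_of_nonneg_left (h _ hi) (by positivity)
    · exact le_rfl

lemma ruelle_nonneg (h : ∀ ξ, avoids S.Q ξ → 0 ≤ F ξ) (ξ : ℕ → Fin p) : 0 ≤ S.ruelle t F ξ :=
  Finset.sum_nonneg fun i _ => by
    split_ifs with hi
    · exact mul_nonneg (by positivity) (h _ hi)
    · exact le_rfl

lemma iterate_ruelle_mono (h : ∀ ξ, avoids S.Q ξ → F ξ ≤ G ξ) (n : ℕ) :
    ∀ ξ, avoids S.Q ξ → (S.ruelle t)^[n] F ξ ≤ (S.ruelle t)^[n] G ξ := by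
  induction n with
  | zero => exact h
  | succ n ih =>
    intro ξ _
    rw [Function.iterate_succ_apply', Function.iterate_succ_apply']
    exact S.ruelle_mono ih ξ

lemma iterate_ruelle_nonneg (h : ∀ ξ, avoids S.Q ξ → 0 ≤ F ξ) (n : ℕ) :
    ∀ ξ, avoids S.Q ξ → 0 ≤ (S.ruelle t)^[n] F ξ := by
  induction n with
  | zero => exact h
  | succ n ih =>
    intro ξ _
    rw [Function.iterate_succ_apply']
    exact S.ruelle_nonneg ih ξ

lemma ruelle_const_mul (c : ℝ) (F : (ℕ → Fin p) → ℝ) :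
    S.ruelle t (fun ξ => c * F ξ) = fun ξ => c * S.ruelle t F ξ := by
  funext ξ
  simp only [ruelle, Finset.mul_sum]
  refine Finset.sum_congr rfl fun i _ => ?_
  split_ifs <;> ring

lemma iterate_ruelle_const_mul (c : ℝ) (F : (ℕ → Fin p) → ℝ) (n : ℕ) :
    (S.ruelle t)^[n] (fun ξ => c * F ξ) = fun ξ => c * (S.ruelle t)^[n] F ξ := by
  induction n with
  | zero => rfl
  | succ n ih =>
    rw [Function.iterate_succ_apply', ih, ruelle_const_mul]
    simp only [Function.iterate_succ_apply']

lemma ruelle_sum {ι : Type*} (s : Finset ι) (F : ι → (ℕ → Fin p) → ℝ) :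
    S.ruelle t (fun ξ => ∑ j ∈ s, F j ξ) = fun ξ => ∑ j ∈ s, S.ruelle t (F j) ξ := by
  funext ξ
  simp only [ruelle]
  rw [Finset.sum_comm]
  refine Finset.sum_congr rfl fun i _ => ?_
  split_ifs
  · exact Finset.mul_sum _ _ _
  · simp

lemma iterate_ruelle_sum {ι : Type*} (s : Finset ι) (F : ι → (ℕ → Fin p) → ℝ) (n : ℕ) :
    (S.ruelle t)^[n] (fun ξ => ∑ j ∈ s, F j ξ) = fun ξ => ∑ j ∈ s, (S.ruelle t)^[n] (F j) ξ := by
  induction n with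
  | zero => rfl
  | succ n ih =>
    rw [Function.iterate_succ_apply', ih, ruelle_sum]
    simp only [Function.iterate_succ_apply']

lemma abs_gder_rpow_le (i : Fin p) {x : ℝ} (hx : x ∈ S.dom) (s t : ℝ) :
    |S.gder i x| ^ s ≤ Real.exp (S.logBound * |s - t|) * |S.gder i x| ^ t := by
  have h0 := S.abs_gder_pos i hx
  rw [Real.rpow_def_of_pos h0, Real.rpow_def_of_pos h0, ← Real.exp_add]
  refine Real.exp_le_exp.2 ?_
  have h1 := le_abs_self (Real.log |S.gder i x| * (s - t))
  rw [abs_mul] at h1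
  have h2 := mul_le_mul_of_nonneg_right (S.abs_log_gder_le i hx) (abs_nonneg (s - t))
  linarith

lemma iterate_ruelle_one_le (s t : ℝ) (n : ℕ) : ∀ ξ, avoids S.Q ξ →
    (S.ruelle s)^[n] 1 ξ ≤ Real.exp (S.logBound * |s - t| * n) * (S.ruelle t)^[n] 1 ξ := by
  induction n with
  | zero => simp
  | succ n ih =>
    intro ξ _
    rw [Function.iterate_succ_apply', Function.iterate_succ_apply']
    refine (S.ruelle_mono ih ξ).trans ?_
    rw [ruelle_const_mul]
    simp only [ruelle, Finset.mul_sum]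
    refine Finset.sum_le_sum fun i _ => ?_
    split_ifs with hi
    · have h1 := S.abs_gder_rpow_le i (S.code_mem_dom ξ) s t
      have h2 := S.iterate_ruelle_nonneg (t := t) (F := 1) (fun _ _ => zero_le_one) n _ hi
      calc _ ≤ Real.exp (S.logBound * |s - t| * n) *
            ((Real.exp (S.logBound * |s - t|) * |S.gder i (S.code ξ)| ^ t) *
              (S.ruelle t)^[n] 1 (consSeq i ξ)) := by gcongr
        _ = _ := by push_cast; rw [mul_add, mul_one, Real.exp_add]; ring
    · simp

lemma one_le_iterate_ruelle_zero (n : ℕ) : ∀ ξ, avoids S.Q ξ → 1 ≤ (S.ruelle 0)^[n] 1 ξ := by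
  induction n with
  | zero => simp
  | succ n ih =>
    intro ξ hξ
    rw [Function.iterate_succ_apply']
    obtain ⟨ω, hω, h⟩ := S.hQinv ξ hξ
    have hc : consSeq (ω 0) ξ = ω := by
      rw [← show shiftSeq 1 ω = ξ by funext n; rw [← h, shiftSeq_apply, add_comm],
        consSeq_head_shiftSeq]
    have hnn : ∀ i, 0 ≤ if avoids S.Q (consSeq i ξ) then |S.gder i (S.code ξ)| ^ (0 : ℝ) *
        (S.ruelle 0)^[n] 1 (consSeq i ξ) else 0 := fun i => by
      split_ifs with hi
      · exact mul_nonneg (by positivity) (zero_le_one.trans (ih _ hi))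
      · exact le_rfl
    refine le_trans ?_ (Finset.single_le_sum (fun i _ => hnn i) (Finset.mem_univ (ω 0)))
    rw [hc, if_pos hω, Real.rpow_zero, one_mul]
    exact ih ω hω

/-- The iterates of the Ruelle operator at the parameter `t` grow subexponentially. -/
def HasSubexpGrowth (t : ℝ) : Prop :=
  ∀ ε > 0, ∃ C : ℝ, ∀ (n : ℕ) ξ, avoids S.Q ξ → (S.ruelle t)^[n] 1 ξ ≤ C * Real.exp (ε * n)

/-- At the least parameter of subexponential growth the growth is exactly subexponential. -/
lemma exists_critical (hne : ∃ ξ, avoids S.Q ξ) {t : ℝ} (ht : 0 ≤ t) (hg : S.HasSubexpGrowth t) :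
    ∃ s, 0 ≤ s ∧ s ≤ t ∧ S.HasSubexpGrowth s ∧
      ∀ C c : ℝ, 0 ≤ c → c < 1 → ∃ (n : ℕ) (ξ : _), avoids S.Q ξ ∧
        C * c ^ n < (S.ruelle s)^[n] 1 ξ := by
  set E := {s : ℝ | 0 ≤ s ∧ S.HasSubexpGrowth s} with hE
  have hEbdd : BddBelow E := ⟨0, fun s hs => hs.1⟩
  have hEne : E.Nonempty := ⟨t, ht, hg⟩
  have hs0 : 0 ≤ sInf E := le_csInf hEne fun s hs => hs.1
  have hB := S.logBound_nonneg
  refine ⟨sInf E, hs0, csInf_le hEbdd ⟨ht, hg⟩, fun ε hε => ?_, fun C c hc0 hc1 => ?_⟩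
  · obtain ⟨s, hs, hlt⟩ := exists_lt_of_csInf_lt hEne
      (lt_add_of_pos_right (sInf E) (show 0 < ε / 2 / (S.logBound + 1) by positivity))
    have hle := csInf_le hEbdd hs
    obtain ⟨C, hC⟩ := hs.2 (ε / 2) (by positivity)
    refine ⟨C, fun n ξ hξ => (S.iterate_ruelle_one_le (sInf E) s n ξ hξ).trans ?_⟩
    have h1 : S.logBound * |sInf E - s| ≤ ε / 2 := by
      rw [abs_sub_comm, abs_of_nonneg (sub_nonneg.2 hle)]
      have h2 : s - sInf E ≤ ε / 2 / (S.logBound + 1) := by linarith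
      rw [le_div_iff₀ (by positivity)] at h2
      nlinarith
    have hC0 : 0 ≤ C * Real.exp (ε / 2 * n) :=
      (S.iterate_ruelle_nonneg (fun _ _ => zero_le_one) n ξ hξ).trans (hC n ξ hξ)
    calc _ ≤ Real.exp (S.logBound * |sInf E - s| * n) * (C * Real.exp (ε / 2 * n)) := by
          gcongr; exact hC n ξ hξ
      _ ≤ Real.exp (ε / 2 * n) * (C * Real.exp (ε / 2 * n)) := by gcongr
      _ = C * (Real.exp (ε / 2 * n) * Real.exp (ε / 2 * n)) := by ring
      _ = _ := by rw [← Real.exp_add]; ring_nf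
  · by_contra! hdec
    obtain ⟨ξ₀, hξ₀⟩ := hne
    rcases hs0.eq_or_lt with h0 | hpos
    · have h1 : ∀ n : ℕ, 1 ≤ C * c ^ n := fun n =>
        (S.one_le_iterate_ruelle_zero n ξ₀ hξ₀).trans (by rw [h0]; exact hdec n ξ₀ hξ₀)
      have h2 : Tendsto (fun n : ℕ => C * c ^ n) atTop (nhds (C * 0)) :=
        (tendsto_pow_atTop_nhds_zero_of_lt_one hc0 hc1).const_mul C
      have := ge_of_tendsto' h2 h1
      simp only [mul_zero] at this
      linarith
    · have hev : ∀ᶠ s in nhdsWithin (sInf E) (Iio (sInf E)),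
          0 < s ∧ Real.exp (S.logBound * |s - sInf E|) * c < 1 := by
        refine nhdsWithin_le_nhds ((lt_mem_nhds hpos).and ?_)
        have hcont : Continuous fun s : ℝ => Real.exp (S.logBound * |s - sInf E|) * c := by
          fun_prop
        exact hcont.continuousAt.eventually_lt_const (by simpa using hc1)
      obtain ⟨s, ⟨hs, hsc⟩, hlt⟩ := (hev.and self_mem_nhdsWithin).exists
      have hC0 : 0 ≤ C := zero_le_one.trans (by simpa using hdec 0 ξ₀ hξ₀)
      refine hlt.not_ge (csInf_le hEbdd ⟨hs.le, fun ε hε => ⟨C, fun n ξ hξ => ?_⟩⟩)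
      calc _ ≤ Real.exp (S.logBound * |s - sInf E| * n) * (C * c ^ n) :=
            (S.iterate_ruelle_one_le s (sInf E) n ξ hξ).trans (by gcongr; exact hdec n ξ hξ)
        _ = C * (Real.exp (S.logBound * |s - sInf E|) * c) ^ n := by
            rw [mul_pow, ← Real.exp_nat_mul]; ring_nf
        _ ≤ C * 1 := by gcongr; exact pow_le_one₀ (by positivity) hsc.le
        _ ≤ C * Real.exp (ε * n) := by gcongr; exact Real.one_le_exp (by positivity)

end Ruelle

end ExpansiveMarkovSystem

namespace ExpansiveMarkovSystem

variable {p : ℕ} (S : ExpansiveMarkovSystem p)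

section Separation

lemma exists_pos_le_abs_sub {s t : Set ℝ} (hs : IsCompact s) (ht : IsCompact t)
    (hst : Disjoint s t) : ∃ r > 0, ∀ x ∈ s, ∀ y ∈ t, r ≤ |x - y| := by
  obtain ⟨r, hr, h⟩ := Metric.exists_pos_forall_lt_edist hs ht.isClosed hst
  refine ⟨r, hr, fun x hx y hy => ?_⟩
  have := (h x hx y hy).le
  rw [edist_dist, ← ENNReal.ofReal_coe_nnreal, ENNReal.ofReal_le_ofReal_iff dist_nonneg] at this
  rwa [Real.dist_eq] at this

/-- A lower bound for the lengths of the intervals `I_i`, for the gaps between them and for the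
gaps between their images under the maps `g a`. -/
lemma exists_gap : ∃ δ > 0, (∀ i, ∃ x ∈ S.Isub i, ∃ y ∈ S.Isub i, δ ≤ |x - y|) ∧
    (∀ i j, i ≠ j → ∀ x ∈ S.Isub i, ∀ y ∈ S.Isub j, δ ≤ |x - y|) ∧
    ∀ a i j, i ≠ j → ∀ x ∈ S.Isub i, ∀ y ∈ S.Isub j, δ ≤ |S.g a x - S.g a y| := by
  have key : ∀ {r : ℝ}, 0 < r → ∀ᶠ δ in nhdsWithin (0 : ℝ) (Ioi 0), δ ≤ r := fun hr =>
    nhdsWithin_le_nhds (Iic_mem_nhds hr)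
  have h1 : ∀ᶠ δ in nhdsWithin (0 : ℝ) (Ioi 0),
      ∀ i, ∃ x ∈ S.Isub i, ∃ y ∈ S.Isub i, δ ≤ |x - y| := by
    refine eventually_all.2 fun i => ?_
    obtain ⟨a, b, hab, h⟩ := S.hIsub i
    filter_upwards [key (sub_pos.2 hab)] with δ hδ
    exact ⟨b, h ▸ right_mem_Icc.2 hab.le, a, h ▸ left_mem_Icc.2 hab.le, hδ.trans (le_abs_self _)⟩
  have h2 : ∀ᶠ δ in nhdsWithin (0 : ℝ) (Ioi 0), ∀ i j, i ≠ j →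
      ∀ x ∈ S.Isub i, ∀ y ∈ S.Isub j, δ ≤ |x - y| := by
    refine eventually_all.2 fun i => eventually_all.2 fun j => eventually_imp_distrib_left.2 ?_
    intro hij
    obtain ⟨r, hr, h⟩ := exists_pos_le_abs_sub (S.isCompact_Isub i) (S.isCompact_Isub j)
      (S.hdisj i j hij)
    filter_upwards [key hr] with δ hδ x hx y hy
    exact hδ.trans (h x hx y hy)
  have h3 : ∀ᶠ δ in nhdsWithin (0 : ℝ) (Ioi 0), ∀ a i j, i ≠ j →
      ∀ x ∈ S.Isub i, ∀ y ∈ S.Isub j, δ ≤ |S.g a x - S.g a y| := by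
    refine eventually_all.2 fun a => eventually_all.2 fun i => eventually_all.2 fun j =>
      eventually_imp_distrib_left.2 fun hij => ?_
    have hg := fun i => (S.continuousOn_g a).mono (S.Isub_subset_dom i)
    obtain ⟨r, hr, h⟩ := exists_pos_le_abs_sub ((S.isCompact_Isub i).image_of_continuousOn (hg i))
      ((S.isCompact_Isub j).image_of_continuousOn (hg j))
      (disjoint_image_image fun x hx y hy hxy => disjoint_left.1 (S.hdisj i j hij) hx
        (S.hg_inj a (S.Isub_subset_dom i hx) (S.Isub_subset_dom j hy) hxy ▸ hy))
    filter_upwards [key hr] with δ hδ x hx y hy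
    exact hδ.trans (h _ (mem_image_of_mem _ hx) _ (mem_image_of_mem _ hy))
  obtain ⟨δ, ⟨⟨h1, h2⟩, h3⟩, h0⟩ := (((h1.and h2).and h3).and self_mem_nhdsWithin).exists
  exact ⟨δ, h0, h1, h2, h3⟩

lemma exists_abs_compDer_succ_le {ε δ : ℝ} (hε : 0 < ε) (hδ : 0 < δ) : ∃ κ, 1 ≤ κ * δ ∧
    ∀ (m : ℕ) (ξ : ℕ → Fin p), ∀ y ∈ S.dom, ∀ x ∈ S.Isub (ξ m), ∀ x' ∈ S.Isub (ξ m),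
      δ ≤ |x - x'| →
        |S.compDer (m + 1) ξ y| ≤ κ * Real.exp (ε * m) * |S.comp m ξ x - S.comp m ξ x'| := by
  have hθ := S.lipConst_nonneg
  have hB := S.logBound_nonneg
  obtain ⟨C, hC0, hC⟩ := S.exists_lenSum_le (show 0 < ε / (S.lipConst + 1) by positivity)
  refine ⟨Real.exp (S.lipConst * C + S.logBound) / δ, ?_, fun m ξ y hy x hx x' hx' hxx' => ?_⟩
  · rw [div_mul_cancel₀ _ hδ.ne']
    exact Real.one_le_exp (by positivity)
  obtain ⟨c, hc, hcE⟩ := S.exists_abs_comp_sub_eq m ξ hx hx'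
  have hcI : c ∈ S.Isub (ξ m) := S.uIcc_subset_Isub hx hx' hc
  have h1 := S.abs_compDer_le_of_lenSum_le (interior_subset (S.g_mem_Isub (ξ m) hy)) hcI
    (hC m ξ)
  have h2 : |S.gder (ξ m) y| ≤ Real.exp S.logBound := by
    rw [← Real.exp_log (S.abs_gder_pos (ξ m) hy)]
    exact Real.exp_le_exp.2 ((le_abs_self _).trans (S.abs_log_gder_le _ hy))
  have h3 : Real.exp (S.lipConst * (ε / (S.lipConst + 1) * m + C)) ≤
      Real.exp (ε * m + S.lipConst * C) := by
    refine Real.exp_le_exp.2 ?_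
    have h4 : S.lipConst * (ε / (S.lipConst + 1)) ≤ ε := by
      rw [mul_div_assoc', div_le_iff₀ (by positivity)]
      nlinarith
    have := mul_le_mul_of_nonneg_right h4 (Nat.cast_nonneg (α := ℝ) m)
    linarith
  rw [compDer_succ_right, abs_mul, hcE]
  calc _ ≤ Real.exp (ε * m + S.lipConst * C) * |S.compDer m ξ c| * Real.exp S.logBound := by
        refine mul_le_mul (h1.trans ?_) h2 (abs_nonneg _) (by positivity)
        exact mul_le_mul_of_nonneg_right h3 (abs_nonneg _)
    _ = Real.exp (S.lipConst * C + S.logBound) / δ * Real.exp (ε * m) *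
          (|S.compDer m ξ c| * δ) := by
        rw [Real.exp_add, Real.exp_add]
        field_simp
    _ ≤ _ := by gcongr

/-- Points whose codes split at the index `k` are at distance comparable, up to a subexponential
factor, to the derivative of the branch up to `k`. -/
lemma exists_abs_compDer_le_abs_code_sub {ε : ℝ} (hε : 0 < ε) : ∃ κ, 0 < κ ∧
    ∀ (k : ℕ) (ξ η : ℕ → Fin p), (∀ j < k, ξ j = η j) → ξ k ≠ η k → ∀ y ∈ S.dom,
      |S.compDer k ξ y| ≤ κ * Real.exp (ε * k) * |S.code ξ - S.code η| := by
  obtain ⟨δ, hδ, -, hgap, hgap'⟩ := S.exists_gap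
  obtain ⟨κ, hκ, h⟩ := S.exists_abs_compDer_succ_le hε hδ
  have hκ0 : 0 < κ := pos_of_mul_pos_left (zero_lt_one.trans_le hκ) hδ.le
  refine ⟨κ, hκ0, fun k ξ η hag hne y hy => ?_⟩
  cases k with
  | zero =>
    simp only [compDer_zero, abs_one, CharP.cast_eq_zero, mul_zero, Real.exp_zero, mul_one]
    exact hκ.trans (mul_le_mul_of_nonneg_left
      (hgap _ _ hne _ (S.code_mem_Isub ξ) _ (S.code_mem_Isub η)) hκ0.le)
  | succ m =>
    have hx := fun ξ : ℕ → Fin p => S.code_mem_Isub (shiftSeq (m + 1) ξ)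
    have hcode : ∀ ξ : ℕ → Fin p, S.code ξ = S.comp m ξ (S.g (ξ m) (S.code (shiftSeq (m + 1) ξ))) :=
      fun ξ => by rw [← comp_succ_right, ← code_eq_comp]
    have h1 := h m ξ y hy (S.g (ξ m) (S.code (shiftSeq (m + 1) ξ)))
      (interior_subset (S.g_mem_Isub _ (S.code_mem_dom _)))
      (S.g (ξ m) (S.code (shiftSeq (m + 1) η)))
      (interior_subset (S.g_mem_Isub _ (S.code_mem_dom _)))
      (hgap' _ _ _ (by simpa using hne) _ (hx ξ) _ (hx η))
    rw [← hcode ξ, hag m (Nat.lt_succ_self m), S.comp_congr (n := m) (fun j hj => hag j (by lia)),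
      ← hcode η] at h1
    refine h1.trans ?_
    gcongr
    exact Nat.le_succ m

lemma exists_abs_compDer_le_exp {ε : ℝ} (hε : 0 < ε) : ∃ C, ∀ (k : ℕ) (ξ : ℕ → Fin p),
    ∀ y ∈ S.dom, |S.compDer k ξ y| ≤ C * Real.exp (ε * k) := by
  obtain ⟨δ, hδ, hI, -, -⟩ := S.exists_gap
  obtain ⟨κ, hκ, h⟩ := S.exists_abs_compDer_succ_le hε hδ
  have hκ0 : 0 < κ := pos_of_mul_pos_left (zero_lt_one.trans_le hκ) hδ.le
  refine ⟨max 1 (κ * diam S.I), fun k ξ y hy => ?_⟩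
  cases k with
  | zero => simp
  | succ m =>
    obtain ⟨x, hx, x', hx', hxx'⟩ := hI (ξ m)
    have h1 := h m ξ y hy x hx x' hx' hxx'
    have h2 : |S.comp m ξ x - S.comp m ξ x'| ≤ diam S.I :=
      S.abs_sub_le_diam_I (S.comp_mem_dom m ξ (S.Isub_subset_dom _ hx))
        (S.comp_mem_dom m ξ (S.Isub_subset_dom _ hx'))
    calc _ ≤ κ * Real.exp (ε * m) * diam S.I := h1.trans (by gcongr)
      _ = κ * diam S.I * Real.exp (ε * m) := by ring
      _ ≤ _ := by
        gcongr
        · exact le_max_right _ _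
        · exact Nat.le_succ m

end Separation

end ExpansiveMarkovSystem

/-- A set of vanishing `t`-dimensional Hausdorff measure has countable covers with arbitrarily
small sum of the `t`-th powers of the diameters. -/
lemma exists_cover_of_hausdorffMeasure_eq_zero {s : Set ℝ} {t : ℝ} (ht : 0 < t)
    (h : Measure.hausdorffMeasure t s = 0) {η : ℝ} (hη : 0 < η) :
    ∃ (U : ℕ → Set ℝ) (r : ℕ → ℝ), s ⊆ ⋃ n, U n ∧ (∀ n, 0 < r n) ∧
      (∀ n, ∀ x ∈ U n, ∀ y ∈ U n, |x - y| ≤ r n) ∧ ∀ F : Finset ℕ, ∑ n ∈ F, r n ^ t ≤ η := by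
  have hη2 : ENNReal.ofReal (η / 2) ≠ 0 := (ENNReal.ofReal_pos.2 (half_pos hη)).ne'
  rw [Measure.hausdorffMeasure_apply] at h
  have h1 := ENNReal.iSup_eq_zero.1 (ENNReal.iSup_eq_zero.1 h 1) one_pos
  have h2 := h1.trans_lt (pos_iff_ne_zero.2 hη2)
  simp only [iInf_lt_iff] at h2
  obtain ⟨U, hU, -, hsum⟩ := h2
  have hsup : ∀ n, (⨆ _ : (U n).Nonempty, ediam (U n) ^ t) = ediam (U n) ^ t := fun n => by
    rcases (U n).eq_empty_or_nonempty with h | h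
    · simp [h, ht]
    · simp [h]
  simp only [hsup] at hsum
  obtain ⟨e, he, hesum⟩ := ENNReal.exists_pos_sum_of_countable hη2 ℕ
  set q : ℕ → ENNReal := fun n => ediam (U n) ^ t + e n with hq
  have hqsum : ∑' n, q n ≤ ENNReal.ofReal η := by
    rw [ENNReal.tsum_add, ← add_halves η, ENNReal.ofReal_add (by positivity) (by positivity)]
    exact add_le_add hsum.le hesum.le
  have hqtop : ∀ n, q n ≠ ⊤ := fun n =>
    ((ENNReal.le_tsum n).trans hqsum).trans_lt ENNReal.ofReal_lt_top |>.ne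
  have hq0 : ∀ n, 0 < (q n).toReal := fun n =>
    ENNReal.toReal_pos (by simp [hq, (he n).ne']) (hqtop n)
  refine ⟨U, fun n => (q n).toReal ^ (1 / t), hU, fun n => Real.rpow_pos_of_pos (hq0 n) _,
    fun n x hx y hy => ?_, fun F => ?_⟩
  · have h3 : ENNReal.ofReal (|x - y| ^ t) ≤ q n := by
      rw [← ENNReal.ofReal_rpow_of_nonneg (abs_nonneg _) ht.le, ← Real.dist_eq, ← edist_dist]
      exact (ENNReal.rpow_le_rpow (edist_le_ediam_of_mem hx hy) ht.le).trans le_self_add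
    rw [ENNReal.ofReal_le_iff_le_toReal (hqtop n)] at h3
    rwa [one_div, Real.le_rpow_inv_iff_of_pos (abs_nonneg _) (hq0 n).le ht]
  · have h4 : ∀ n, ((q n).toReal ^ (1 / t)) ^ t = (q n).toReal := fun n => by
      rw [← Real.rpow_mul (hq0 n).le, one_div_mul_cancel ht.ne', Real.rpow_one]
    simp only [h4]
    rw [← ENNReal.toReal_sum fun n _ => hqtop n]
    exact ENNReal.toReal_le_of_le_ofReal hη.le ((ENNReal.sum_le_tsum F).trans hqsum)

namespace ExpansiveMarkovSystem

variable {p : ℕ} (S : ExpansiveMarkovSystem p)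

section Growth

variable {t : ℝ}

lemma iterate_ruelle_indicator_le (ξ : ℕ → Fin p) {n k : ℕ} (hk : k ≤ n) (η : ℕ → Fin p) :
    (S.ruelle t)^[k] (fun ζ => if ∀ j < n, ζ j = ξ j then 1 else 0) η ≤
      if ∀ j < n - k, η j = ξ (k + j) then |S.compDer k ξ (S.code η)| ^ t else 0 := by
  induction k generalizing η with
  | zero => simp
  | succ k ih =>
    rw [Function.iterate_succ_apply']
    refine (S.ruelle_mono (fun ζ _ => ih (by lia) ζ) η).trans ?_
    rw [ruelle, Finset.sum_eq_single (ξ k)]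
    · have hcode : S.code (consSeq (ξ k) η) = S.g (ξ k) (S.code η) := by
        rw [code_eq_g, consSeq_zero, shiftSeq_one_consSeq]
      have hiff : (∀ j < n - k, consSeq (ξ k) η j = ξ (k + j)) ↔
          ∀ j < n - (k + 1), η j = ξ (k + 1 + j) := by
        refine ⟨fun h j hj => ?_, fun h j hj => ?_⟩
        · have := h (j + 1) (by lia)
          rwa [consSeq_succ, ← add_assoc, add_right_comm] at this
        · cases j with
          | zero => simp
          | succ j => rw [consSeq_succ, h j (by lia), add_right_comm, add_assoc]
      rw [hcode, compDer_succ_right, abs_mul, Real.mul_rpow (abs_nonneg _) (abs_nonneg _)]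
      simp only [hiff]
      split_ifs
      · exact (mul_comm _ _).le
      · simp
      · positivity
      · exact le_rfl
    · intro i _ hi
      have h0 : ¬ ∀ j < n - k, consSeq i η j = ξ (k + j) := fun h =>
        hi (by simpa using h 0 (by lia))
      simp only [if_neg h0, mul_zero, ite_self]
    · simp

lemma exists_iterate_ruelle_one_le_pow (t : ℝ) : ∃ M : ℝ, 1 ≤ M ∧
    ∀ (n : ℕ) ξ, avoids S.Q ξ → (S.ruelle t)^[n] 1 ξ ≤ M ^ n := by
  set E := Real.exp (S.logBound * |t - 0|) with hE
  have hle : ∀ ξ, S.ruelle t (fun _ => 1) ξ ≤ p * E := fun ξ => by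
    have : ∀ i ∈ Finset.univ, (if avoids S.Q (consSeq i ξ) then
        |S.gder i (S.code ξ)| ^ t * 1 else 0) ≤ E := fun i _ => by
      split_ifs
      · simpa [hE] using S.abs_gder_rpow_le i (S.code_mem_dom ξ) t 0
      · positivity
    simpa [ruelle] using Finset.sum_le_card_nsmul Finset.univ _ _ this
  refine ⟨max 1 (p * E), le_max_left _ _, fun n => ?_⟩
  induction n with
  | zero => simp
  | succ n ih =>
    intro ξ _
    rw [Function.iterate_succ_apply']
    refine (S.ruelle_mono (G := fun _ => max 1 (p * E) ^ n * 1) (by simpa using ih) ξ).trans ?_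
    rw [ruelle_const_mul, pow_succ]
    exact mul_le_mul_of_nonneg_left ((hle ξ).trans (le_max_right _ _)) (by positivity)

/-- A renewal inequality: subexponential growth from a finite cover by cylinders of small total
weight. -/
lemma exists_growth_of_cover {ι : Type*} (s : Finset ι) (ξ : ι → ℕ → Fin p) (k : ι → ℕ)
    (w : ι → ℝ) {ε : ℝ} (hε : 0 < ε) (hk : ∀ j ∈ s, k j ≠ 0) (hw : ∀ j ∈ s, 0 ≤ w j)
    (hsum : ∑ j ∈ s, w j ≤ 1)
    (hcov : ∀ ζ, avoids S.Q ζ → ∃ j ∈ s, ∀ i < k j, ζ i = ξ j i)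
    (hder : ∀ j ∈ s, ∀ y ∈ S.dom, |S.compDer (k j) (ξ j) y| ^ t ≤ w j * Real.exp (ε * k j)) :
    ∃ C : ℝ, ∀ (n : ℕ) ζ, avoids S.Q ζ → (S.ruelle t)^[n] 1 ζ ≤ C * Real.exp (ε * n) := by
  obtain ⟨M, hM1, hM⟩ := S.exists_iterate_ruelle_one_le_pow t
  set N := s.sup k with hN
  refine ⟨M ^ N, fun n => ?_⟩
  induction n using Nat.strong_induction_on with
  | _ n ih =>
    intro ζ hζ
    rcases le_or_gt n N with hn | hn
    · refine (hM n ζ hζ).trans ((pow_le_pow_right₀ hM1 hn).trans ?_)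
      exact le_mul_of_one_le_right (by positivity) (Real.one_le_exp (by positivity))
    have hkn : ∀ j ∈ s, k j ≤ n := fun j hj => (Finset.le_sup hj).trans hn.le
    have h1 := S.iterate_ruelle_mono (t := t) (F := 1)
      (G := fun ζ => ∑ j ∈ s, if ∀ i < k j, ζ i = ξ j i then 1 else 0) (fun ζ hζ => by
        obtain ⟨j, hj, h⟩ := hcov ζ hζ
        refine le_trans ?_ (Finset.single_le_sum (fun i _ => by positivity) hj)
        rw [if_pos h, Pi.one_apply]) n ζ hζ
    rw [iterate_ruelle_sum] at h1
    refine h1.trans ?_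
    have h2 : ∀ j ∈ s, (S.ruelle t)^[n] (fun ζ => if ∀ i < k j, ζ i = ξ j i then 1 else 0) ζ ≤
        w j * (M ^ N * Real.exp (ε * n)) := fun j hj => by
      have hsplit : n = (n - k j) + k j := (Nat.sub_add_cancel (hkn j hj)).symm
      conv_lhs => rw [hsplit, Function.iterate_add_apply]
      have h3 := S.iterate_ruelle_mono (t := t)
        (F := (S.ruelle t)^[k j] fun ζ => if ∀ i < k j, ζ i = ξ j i then 1 else 0)
        (G := fun ζ => w j * Real.exp (ε * k j) * (1 : (ℕ → Fin p) → ℝ) ζ) (fun η _ => by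
          refine (S.iterate_ruelle_indicator_le (ξ j) le_rfl η).trans ?_
          rw [if_pos (by simp), Pi.one_apply, mul_one]
          exact hder j hj _ (S.code_mem_dom η)) (n - k j) ζ hζ
      rw [iterate_ruelle_const_mul] at h3
      have h4 := hw j hj
      have h5 := hk j hj
      have h6 := hkn j hj
      calc _ ≤ w j * Real.exp (ε * k j) * (M ^ N * Real.exp (ε * (n - k j : ℕ))) :=
            h3.trans (mul_le_mul_of_nonneg_left (ih _ (by lia) ζ hζ) (by positivity))
        _ = w j * (M ^ N * (Real.exp (ε * k j) * Real.exp (ε * (n - k j : ℕ)))) := by ring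
        _ = _ := by rw [← Real.exp_add, ← mul_add, ← Nat.cast_add, Nat.add_sub_cancel' h6]
    calc _ ≤ ∑ j ∈ s, w j * (M ^ N * Real.exp (ε * n)) := Finset.sum_le_sum h2
      _ = (∑ j ∈ s, w j) * (M ^ N * Real.exp (ε * n)) := (Finset.sum_mul _ _ _).symm
      _ ≤ _ := mul_le_of_le_one_left (by positivity) hsum

/-- Above the dimension of the limit set the Ruelle operators grow subexponentially. -/
lemma hasSubexpGrowth_of_dimH_lt (h : dimH S.limitSet < ENNReal.ofReal t) :
    S.HasSubexpGrowth t := by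
  have ht : 0 < t := ENNReal.ofReal_pos.1 (zero_le.trans_lt h)
  have h0 : Measure.hausdorffMeasure t S.limitSet = 0 := by
    have := hausdorffMeasure_of_dimH_lt (d := t.toNNReal) h
    rwa [Real.coe_toNNReal t ht.le] at this
  intro ε hε
  obtain ⟨κ, hκ, hsep⟩ := S.exists_abs_compDer_le_abs_code_sub (div_pos hε ht)
  set ε₁ := ε / t with hε₁
  have hε₁0 : 0 < ε₁ := div_pos hε ht
  obtain ⟨U, r, hcov, hr, hdiam, hsum⟩ := exists_cover_of_hausdorffMeasure_eq_zero ht h0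
    (show 0 < 1 / (2 * κ ^ t) by positivity)
  have hrκ : ∀ F : Finset ℕ, ∑ n ∈ F, (κ * r n) ^ t ≤ 1 / 2 := fun F => by
    calc _ = κ ^ t * ∑ n ∈ F, r n ^ t := by
          rw [Finset.mul_sum]
          exact Finset.sum_congr rfl fun n _ => Real.mul_rpow hκ.le (hr n).le
      _ ≤ κ ^ t * (1 / (2 * κ ^ t)) := by gcongr; exact hsum F
      _ = _ := by field_simp
  obtain ⟨D, hD⟩ := S.exists_abs_compDer_le_exp (half_pos hε₁0)
  have hex : ∀ n (ξ : ℕ → Fin p), ∃ k : ℕ, ∀ y ∈ S.dom,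
      |S.compDer k ξ y| ≤ κ * Real.exp (ε₁ * k) * r n := fun n ξ => by
    have htop : Tendsto (fun k : ℕ => Real.exp (ε₁ / 2 * k)) atTop atTop :=
      Real.tendsto_exp_atTop.comp (tendsto_natCast_atTop_atTop.const_mul_atTop (half_pos hε₁0))
    obtain ⟨k, hk⟩ := (htop.eventually_ge_atTop (D / (κ * r n))).exists
    refine ⟨k, fun y hy => (hD k ξ y hy).trans ?_⟩
    rw [div_le_iff₀ (mul_pos hκ (hr n))] at hk
    calc _ ≤ Real.exp (ε₁ / 2 * k) * (κ * r n) * Real.exp (ε₁ / 2 * k) := by gcongr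
      _ = κ * (Real.exp (ε₁ / 2 * k) * Real.exp (ε₁ / 2 * k)) * r n := by ring
      _ = _ := by rw [← Real.exp_add, ← add_mul, add_halves]
  have hmin : ∀ n (ξ : ℕ → Fin p), ∃ k : ℕ,
      (∀ y ∈ S.dom, |S.compDer k ξ y| ≤ κ * Real.exp (ε₁ * k) * r n) ∧
      ∀ m < k, ¬ ∀ y ∈ S.dom, |S.compDer m ξ y| ≤ κ * Real.exp (ε₁ * m) * r n := fun n ξ =>
    ⟨Nat.find (hex n ξ), Nat.find_spec (hex n ξ), fun m hm => Nat.find_min (hex n ξ) hm⟩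
  choose k hkle hkmin using hmin
  have hk0 : ∀ n ξ, k n ξ ≠ 0 := fun n ξ hk => by
    have h1 := hkle n ξ _ (S.code_mem_dom ξ)
    rw [hk] at h1
    simp only [compDer_zero, abs_one, CharP.cast_eq_zero, mul_zero, Real.exp_zero, mul_one] at h1
    have h2 := hrκ {n}
    rw [Finset.sum_singleton] at h2
    linarith [Real.one_le_rpow h1 ht.le]
  set J := {n // ∃ ξ, avoids S.Q ξ ∧ S.code ξ ∈ U n} with hJ
  choose ξ hξ hξU using fun j : J => j.2
  have hJcov : ∀ ζ, avoids S.Q ζ → ∃ j : J, ∀ i < k j (ξ j), ζ i = ξ j i := by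
    intro ζ hζ
    have hmem : S.code ζ ∈ S.limitSet := by rw [limitSet_eq]; exact mem_image_of_mem _ hζ
    obtain ⟨n, hn⟩ := mem_iUnion.1 (hcov hmem)
    set j : J := ⟨n, ζ, hζ, hn⟩ with hj
    refine ⟨j, ?_⟩
    by_contra! hne
    have hspec := Nat.find_spec hne
    refine hkmin j (ξ j) (Nat.find hne) hspec.1 fun y hy => ?_
    refine (hsep _ (ξ j) ζ (fun i hi => ?_) hspec.2.symm y hy).trans ?_
    · by_contra hi'
      exact Nat.find_min hne hi ⟨hi.trans hspec.1, fun h => hi' h.symm⟩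
    · exact mul_le_mul_of_nonneg_left (hdiam n _ (hξU j) _ hn) (by positivity)
  obtain ⟨F, hF⟩ := (isClosed_avoids S.Q).isCompact.elim_finite_subcover
    (fun j : J => {ζ | ∀ i < k j (ξ j), ζ i = ξ j i}) (fun j => by
      simp only [ofPred_forall]
      exact (finite_lt_nat _).isOpen_biInter fun i _ =>
        (isOpen_discrete {ξ j i}).preimage (f := fun ζ : ℕ → Fin p => ζ i) (continuous_apply i))
    (fun ζ hζ => mem_iUnion.2 (hJcov ζ hζ))
  refine S.exists_growth_of_cover F ξ (fun j => k j (ξ j)) (fun j => (κ * r j) ^ t) hε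
    (fun j _ => hk0 j (ξ j)) (fun j _ => Real.rpow_nonneg (mul_pos hκ (hr j)).le _) ?_
    (fun ζ hζ => by simpa using hF hζ) fun j _ y hy => ?_
  · have := hrκ (F.map (Function.Embedding.subtype _))
    rw [Finset.sum_map] at this
    exact this.trans (by norm_num)
  · have h1 := Real.rpow_le_rpow (abs_nonneg _) (hkle j (ξ j) y hy) ht.le
    refine h1.trans_eq ?_
    rw [mul_right_comm, Real.mul_rpow (mul_pos hκ (hr j)).le (Real.exp_pos _).le, ← Real.exp_mul,
      hε₁]
    congr 2
    field_simp

end Growth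

end ExpansiveMarkovSystem

/-- The Riesz representation of a state on the continuous functions of a compact space. -/
lemma exists_isProbabilityMeasure_of_state {X : Type*} [TopologicalSpace X] [T2Space X]
    [CompactSpace X] [MeasurableSpace X] [BorelSpace X] (F : C(X, ℝ) →ₗ[ℝ] ℝ)
    (hF : ∀ φ, 0 ≤ φ → 0 ≤ F φ) (h1 : F 1 = 1) :
    ∃ μ : Measure X, IsProbabilityMeasure μ ∧ ∀ φ : C(X, ℝ), ∫ x, φ x ∂μ = F φ := by
  set e := CompactlySupportedContinuousMap.continuousMapEquiv (α := X) (β := ℝ) with he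
  let L : CompactlySupportedContinuousMap X ℝ →ₚ[ℝ] ℝ := PositiveLinearMap.mk₀
    { toFun := fun φ => F (e.symm φ)
      map_add' := fun φ ψ => by rw [← map_add]; rfl
      map_smul' := fun c φ => by rw [RingHom.id_apply, ← map_smul]; rfl }
    fun φ hφ => hF _ fun x => hφ x
  have hint : ∀ φ : C(X, ℝ), ∫ x, φ x ∂(RealRMK.rieszMeasure L) = F φ := fun φ =>
    RealRMK.integral_rieszMeasure L (e φ)
  have := RealRMK.regular_rieszMeasure L
  refine ⟨RealRMK.rieszMeasure L, ⟨?_⟩, hint⟩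
  have h2 := hint 1
  rw [h1] at h2
  simp only [ContinuousMap.one_apply, integral_const, smul_eq_mul, mul_one, Measure.real] at h2
  rwa [ENNReal.toReal_eq_one_iff] at h2

namespace ExpansiveMarkovSystem

variable {p : ℕ} (S : ExpansiveMarkovSystem p)

section ConformalMeasure

variable {t : ℝ}

lemma continuous_consSeq (i : Fin p) : Continuous (consSeq i) :=
  continuous_pi fun k => by
    cases k with
    | zero => exact continuous_const
    | succ k => exact continuous_apply k

lemma continuous_abs_gder_rpow (i : Fin p) (t : ℝ) :
    Continuous fun ξ => |S.gder i (S.code ξ)| ^ t :=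
  ((S.hgder_cont i).comp_continuous S.continuous_code S.code_mem_dom).abs.rpow_const
    fun ξ => Or.inl (S.abs_gder_pos i (S.code_mem_dom ξ)).ne'

lemma isClosed_avoids_consSeq (i : Fin p) : IsClosed {ξ | avoids S.Q (consSeq i ξ)} :=
  (isClosed_avoids S.Q).preimage (continuous_consSeq i)

lemma continuousOn_ruelle {F : (ℕ → Fin p) → ℝ} (hF : ContinuousOn F {ξ | avoids S.Q ξ}) :
    ContinuousOn (S.ruelle t F) {ξ | avoids S.Q ξ} := by
  refine continuousOn_finsetSum _ fun i _ ξ hξ => ?_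
  by_cases hi : avoids S.Q (consSeq i ξ)
  · have hev : ∀ᶠ η in nhdsWithin ξ {ξ | avoids S.Q ξ}, avoids S.Q (consSeq i η) := by
      filter_upwards [self_mem_nhdsWithin,
        nhdsWithin_le_nhds (eventually_agree ξ (S.Q.sup List.length))] with η hη h
      exact avoids_consSeq_of_agree hi hη fun j hj => (h j hj.le).symm
    have hc : ContinuousWithinAt (fun η => |S.gder i (S.code η)| ^ t * F (consSeq i η))
        {ξ | avoids S.Q ξ} ξ := by
      refine (S.continuous_abs_gder_rpow i t).continuousWithinAt.mul ?_
      exact (hF _ hi).tendsto.comp (tendsto_nhdsWithin_iff.2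
        ⟨(continuous_consSeq i).continuousWithinAt.tendsto, hev⟩)
    refine hc.congr_of_eventuallyEq ?_ (if_pos hi)
    filter_upwards [hev] with η hη
    exact if_pos hη
  · have hev : ∀ᶠ η in nhdsWithin ξ {ξ | avoids S.Q ξ}, ¬ avoids S.Q (consSeq i η) :=
      nhdsWithin_le_nhds ((S.isClosed_avoids_consSeq i).isOpen_compl.mem_nhds hi)
    refine (continuousWithinAt_const (b := (0 : ℝ))).congr_of_eventuallyEq ?_ (if_neg hi)
    filter_upwards [hev] with η hη
    exact if_neg hη

/-- The extension by zero of a function on the subshift. -/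
noncomputable def extend (φ : {ξ // avoids S.Q ξ} → ℝ) (ξ : ℕ → Fin p) : ℝ :=
  if h : avoids S.Q ξ then φ ⟨ξ, h⟩ else 0

lemma extend_apply (φ : {ξ // avoids S.Q ξ} → ℝ) (x : {ξ // avoids S.Q ξ}) :
    S.extend φ x = φ x := dif_pos x.2

lemma continuousOn_extend (φ : C({ξ // avoids S.Q ξ}, ℝ)) :
    ContinuousOn (S.extend φ) {ξ | avoids S.Q ξ} :=
  continuousOn_iff_continuous_domRestrict.2 (φ.continuous.congr fun x => (S.extend_apply φ x).symm)

/-- The Ruelle operator on the continuous functions of the subshift. -/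
noncomputable def ruelleOp (t : ℝ) :
    C({ξ // avoids S.Q ξ}, ℝ) →ₗ[ℝ] C({ξ // avoids S.Q ξ}, ℝ) where
  toFun φ := ⟨fun x => S.ruelle t (S.extend φ) x,
    continuousOn_iff_continuous_domRestrict.1 (S.continuousOn_ruelle (S.continuousOn_extend φ))⟩
  map_add' φ ψ := by
    ext x
    simp only [ruelle, ContinuousMap.coe_mk, ContinuousMap.add_apply, ← Finset.sum_add_distrib]
    refine Finset.sum_congr rfl fun i _ => ?_
    split_ifs with hi
    · simp [extend, hi, mul_add]
    · simp
  map_smul' c φ := by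
    ext x
    simp only [ruelle, ContinuousMap.coe_mk, ContinuousMap.smul_apply, smul_eq_mul,
      RingHom.id_apply, Finset.mul_sum]
    refine Finset.sum_congr rfl fun i _ => ?_
    split_ifs with hi
    · simp [extend, hi]; ring
    · simp

lemma ruelle_congr {F G : (ℕ → Fin p) → ℝ} (h : ∀ ξ, avoids S.Q ξ → F ξ = G ξ) :
    S.ruelle t F = S.ruelle t G :=
  funext fun ξ => Finset.sum_congr rfl fun i _ => by
    split_ifs with hi
    · rw [h _ hi]
    · rfl

lemma ruelleOp_apply_eq {φ : C({ξ // avoids S.Q ξ}, ℝ)} {F : (ℕ → Fin p) → ℝ}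
    (h : ∀ x : {ξ // avoids S.Q ξ}, φ x = F x) (x : {ξ // avoids S.Q ξ}) :
    S.ruelleOp t φ x = S.ruelle t F x :=
  congrFun (S.ruelle_congr fun ξ hξ => (S.extend_apply φ ⟨ξ, hξ⟩).trans (h _)) _

lemma ruelleOp_pow_one_apply (n : ℕ) (x : {ξ // avoids S.Q ξ}) :
    (S.ruelleOp t ^ n) 1 x = (S.ruelle t)^[n] 1 x := by
  induction n generalizing x with
  | zero => rfl
  | succ n ih =>
    rw [pow_succ', Module.End.mul_apply, Function.iterate_succ_apply', S.ruelleOp_apply_eq ih]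

/-- An eigenmeasure of the dual of the Ruelle operator. -/
lemma exists_eigenmeasure (hne : ∃ ξ, avoids S.Q ξ) (hg : S.HasSubexpGrowth t)
    (hd : ∀ C c : ℝ, 0 ≤ c → c < 1 → ∃ (n : ℕ) (ξ : _), avoids S.Q ξ ∧
      C * c ^ n < (S.ruelle t)^[n] 1 ξ) :
    ∃ m : Measure (ℕ → Fin p), IsProbabilityMeasure m ∧ m {ξ | avoids S.Q ξ}ᶜ = 0 ∧
      ∀ φ : (ℕ → Fin p) → ℝ, Continuous φ → ∫ ξ, φ ξ ∂m = ∫ ξ, S.ruelle t φ ξ ∂m := by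
  have : Nonempty {ξ // avoids S.Q ξ} := nonempty_subtype.2 hne
  have : CompactSpace {ξ // avoids S.Q ξ} :=
    isCompact_iff_compactSpace.1 (isClosed_avoids S.Q).isCompact
  obtain ⟨F, hF, hF1, hinv⟩ := exists_invariant_state (T := S.ruelleOp t)
    (fun φ hφ x => S.ruelle_nonneg (fun ξ hξ => by
      rw [S.extend_apply φ ⟨ξ, hξ⟩]; exact hφ ⟨ξ, hξ⟩) x)
    (fun ε hε => by
      obtain ⟨C, hC⟩ := hg ε hε
      exact ⟨C, fun n x => (S.ruelleOp_pow_one_apply n x).trans_le (hC n x x.2)⟩)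
    (fun C c hc0 hc1 => by
      obtain ⟨n, ξ, hξ, h⟩ := hd C c hc0 hc1
      exact ⟨n, ⟨ξ, hξ⟩, h.trans_eq (S.ruelleOp_pow_one_apply n ⟨ξ, hξ⟩).symm⟩)
  obtain ⟨μ, hμ, hint⟩ := exists_isProbabilityMeasure_of_state F hF hF1
  have hemb : MeasurableEmbedding (Subtype.val : {ξ // avoids S.Q ξ} → ℕ → Fin p) :=
    MeasurableEmbedding.subtype_coe (isClosed_avoids S.Q).measurableSet
  refine ⟨μ.map Subtype.val, Measure.isProbabilityMeasure_map hemb.measurable.aemeasurable, ?_,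
    fun φ hφ => ?_⟩
  · rw [hemb.map_apply]
    convert measure_empty (μ := μ)
    ext x
    simpa using x.2
  · rw [hemb.integral_map, hemb.integral_map]
    set ψ : C({ξ // avoids S.Q ξ}, ℝ) := ⟨fun x => φ x, hφ.comp continuous_subtype_val⟩ with hψ
    have h1 : ∀ x, S.ruelleOp t ψ x = S.ruelle t φ x := S.ruelleOp_apply_eq fun x => rfl
    simp only [← h1, hint, hinv]
    exact hint ψ

lemma lintegral_eq_sum_of_eigenmeasure {m : Measure (ℕ → Fin p)} [IsProbabilityMeasure m]
    (hm : ∀ φ : (ℕ → Fin p) → ℝ, Continuous φ → ∫ ξ, φ ξ ∂m = ∫ ξ, S.ruelle t φ ξ ∂m)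
    {h : (ℕ → Fin p) → ENNReal} (hh : Measurable h) :
    ∫⁻ ξ, h ξ ∂m = ∑ i, ∫⁻ ξ in {ξ | avoids S.Q (consSeq i ξ)},
      ENNReal.ofReal (|S.gder i (S.code ξ)| ^ t) * h (consSeq i ξ) ∂m := by
  set w : Fin p → (ℕ → Fin p) → ℝ := fun i ξ => |S.gder i (S.code ξ)| ^ t with hw
  have hwc : ∀ i, Continuous (w i) := fun i => S.continuous_abs_gder_rpow i t
  have hw0 : ∀ i ξ, 0 ≤ w i ξ := fun i ξ => by positivity
  have hbdd : ∀ φ : (ℕ → Fin p) → ℝ, Continuous φ → ∀ μ : Measure (ℕ → Fin p),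
      IsFiniteMeasure μ → Integrable φ μ := fun φ hφ μ _ =>
    hφ.integrable_of_hasCompactSupport (HasCompactSupport.of_compactSpace φ)
  set m' : Fin p → Measure (ℕ → Fin p) := fun i =>
    ((m.restrict {ξ | avoids S.Q (consSeq i ξ)}).withDensity
      fun ξ => ENNReal.ofReal (w i ξ)).map (consSeq i) with hm'
  have hwm : ∀ i, Measurable fun ξ => ENNReal.ofReal (w i ξ) := fun i =>
    (hwc i).measurable.ennreal_ofReal
  have hfin : ∀ i, IsFiniteMeasure (m' i) := fun i => by
    have := isFiniteMeasure_withDensity_ofReal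
      (hbdd _ (hwc i) (m.restrict {ξ | avoids S.Q (consSeq i ξ)}) inferInstance).2
    exact Measure.isFiniteMeasure_map _ _
  have hfin' : IsFiniteMeasure (∑ i, m' i) := inferInstance
  have heq : m = ∑ i, m' i := by
    refine ext_of_forall_integral_eq_of_IsFiniteMeasure fun φ => ?_
    rw [hm φ φ.continuous, integral_finsetSum_measure fun i _ => hbdd φ φ.continuous _ (hfin i)]
    have hc : ∀ i, Continuous fun ξ => w i ξ * φ (consSeq i ξ) := fun i =>
      (hwc i).mul (φ.continuous.comp (continuous_consSeq i))
    have hD := fun i => (S.isClosed_avoids_consSeq i).measurableSet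
    change ∫ ξ, ∑ i, indicator {ξ | avoids S.Q (consSeq i ξ)}
      (fun ξ => w i ξ * φ (consSeq i ξ)) ξ ∂m = _
    rw [integral_finsetSum _ fun i _ => (hbdd _ (hc i) m inferInstance).indicator (hD i)]
    refine Finset.sum_congr rfl fun i _ => ?_
    rw [integral_map (continuous_consSeq i).measurable.aemeasurable
      φ.continuous.aestronglyMeasurable, integral_withDensity_eq_integral_toReal_smul (hwm i)
      (Eventually.of_forall fun _ => ENNReal.ofReal_lt_top)]
    simp only [ENNReal.toReal_ofReal (hw0 i _), smul_eq_mul]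
    exact integral_indicator (hD i)
  conv_lhs => rw [heq]
  rw [lintegral_finsetSum_measure]
  refine Finset.sum_congr rfl fun i _ => ?_
  have hhc := hh.comp (continuous_consSeq i).measurable
  rw [lintegral_map hh (continuous_consSeq i).measurable]
  exact lintegral_withDensity_eq_lintegral_mul _ (hwm i) hhc

lemma exists_isConformal (hne : ∃ ξ, avoids S.Q ξ) (hg : S.HasSubexpGrowth t)
    (hd : ∀ C c : ℝ, 0 ≤ c → c < 1 → ∃ (n : ℕ) (ξ : _), avoids S.Q ξ ∧
      C * c ^ n < (S.ruelle t)^[n] 1 ξ) : ∃ ν : Measure ℝ, S.IsConformal ν t := by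
  obtain ⟨m, hm1, hm0, hm⟩ := S.exists_eigenmeasure hne hg hd
  have hemb := S.isClosedEmbedding_code.measurableEmbedding
  refine ⟨m.map S.code, Measure.isProbabilityMeasure_map hemb.measurable.aemeasurable, ?_, ?_⟩
  · rw [hemb.map_apply]
    have hsub : S.code ⁻¹' S.limitSetᶜ ⊆ {ξ | avoids S.Q ξ}ᶜ := fun ξ hξ h => hξ (by
      rw [limitSet_eq]
      exact mem_image_of_mem _ h)
    exact measure_mono_null hsub hm0
  intro A hA hAΛ hinj
  set B := S.code ⁻¹' A with hB
  have hBm : MeasurableSet B := hemb.measurable hA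
  have hBQ : ∀ ξ ∈ B, avoids S.Q ξ := fun ξ hξ => by
    have := hAΛ hξ
    rw [limitSet_eq] at this
    obtain ⟨η, hη, h⟩ := this
    rwa [← S.code_injective h]
  have hpre : S.code ⁻¹' (S.f '' A) = ⋃ i, consSeq i ⁻¹' B := by
    ext ξ
    simp only [mem_preimage, mem_image, mem_iUnion]
    constructor
    · rintro ⟨x, hx, hxξ⟩
      have := hAΛ hx
      rw [limitSet_eq] at this
      obtain ⟨η, hη, rfl⟩ := this
      rw [f_code] at hxξ
      refine ⟨η 0, ?_⟩
      rw [← S.code_injective hxξ, consSeq_head_shiftSeq]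
      exact hx
    · rintro ⟨i, hi⟩
      exact ⟨_, hi, by rw [f_code, shiftSeq_one_consSeq]⟩
  have hdisj : Pairwise (Function.onFun Disjoint fun i => consSeq i ⁻¹' B) := by
    refine fun i j hij => disjoint_left.2 fun ξ hi hj => hij ?_
    have := S.code_injective (hinj hi hj (by simp [f_code]))
    simpa using congrFun this 0
  set h : (ℕ → Fin p) → ENNReal := fun ξ => ENNReal.ofReal (|S.fder (S.code ξ)| ^ t) with hh
  have hhm : Measurable h := by
    have hc : Continuous fun z : Fin p × (ℕ → Fin p) => |S.gder z.1 (S.code z.2)| ^ t :=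
      continuous_prod_of_discrete_left.2 fun i => S.continuous_abs_gder_rpow i t
    have hc' : Continuous fun ξ : ℕ → Fin p =>
        (|S.gder (ξ 0) (S.code (shiftSeq 1 ξ))| ^ t)⁻¹ :=
      (hc.comp ((continuous_apply 0).prodMk (continuous_shiftSeq 1))).inv₀ fun ξ =>
        (Real.rpow_pos_of_pos (S.abs_gder_pos _ (S.code_mem_dom _)) t).ne'
    have : h = fun ξ => ENNReal.ofReal ((|S.gder (ξ 0) (S.code (shiftSeq 1 ξ))| ^ t)⁻¹) := by
      funext ξ
      rw [hh]
      simp only [fder_code, abs_inv, Real.inv_rpow (abs_nonneg _)]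
    rw [this]
    exact hc'.measurable.ennreal_ofReal
  rw [hemb.map_apply, hpre, measure_iUnion hdisj
    fun i => (continuous_consSeq i).measurable hBm, tsum_fintype, hemb.restrict_map,
    hemb.lintegral_map, ← lintegral_indicator hBm,
    S.lintegral_eq_sum_of_eigenmeasure hm (hhm.indicator hBm)]
  refine Finset.sum_congr rfl fun i _ => ?_
  have hterm : ∀ ξ, ENNReal.ofReal (|S.gder i (S.code ξ)| ^ t) * B.indicator h (consSeq i ξ) =
      (consSeq i ⁻¹' B).indicator 1 ξ := fun ξ => by
    by_cases hξ : consSeq i ξ ∈ B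
    · rw [indicator_of_mem hξ, indicator_of_mem (show ξ ∈ consSeq i ⁻¹' B from hξ), hh]
      simp only [fder_code, consSeq_zero, shiftSeq_one_consSeq, abs_inv, Pi.one_apply]
      have h0 := S.abs_gder_pos i (S.code_mem_dom ξ)
      rw [← ENNReal.ofReal_mul (by positivity), ← Real.mul_rpow h0.le (by positivity),
        mul_inv_cancel₀ h0.ne', Real.one_rpow, ENNReal.ofReal_one]
    · rw [indicator_of_notMem hξ, indicator_of_notMem (show ξ ∉ consSeq i ⁻¹' B from hξ), mul_zero]
  simp only [hterm]
  rw [lintegral_indicator_one ((continuous_consSeq i).measurable hBm),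
    Measure.restrict_apply ((continuous_consSeq i).measurable hBm),
    inter_eq_left.2 (show consSeq i ⁻¹' B ⊆ {ξ | avoids S.Q (consSeq i ξ)} from
      fun ξ hξ => hBQ _ hξ)]

end ConformalMeasure

end ExpansiveMarkovSystem

/-- The Hausdorff dimension of `Λ_Q` equals
`t_c = inf {t ≥ 0 : there exists a t-conformal measure supported on Λ_Q}`. -/
theorem dimH_limitSet_eq_tc {p : ℕ} (S : ExpansiveMarkovSystem p) :
    dimH S.limitSet = ENNReal.ofReal S.tc := by
  have hbdd : BddBelow {t : ℝ | 0 ≤ t ∧ ∃ ν : Measure ℝ, S.IsConformal ν t} := ⟨0, fun t ht => ht.1⟩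
  by_cases hne : ∃ ξ, avoids S.Q ξ
  · have hfin : dimH S.limitSet ≠ ⊤ :=
      ((dimH_mono (subset_univ _)).trans_lt (by rw [Real.dimH_univ]; exact ENNReal.one_lt_top)).ne
    rw [← ENNReal.ofReal_toReal hfin]
    congr 1
    have hcrit : ∀ t : ℝ, (dimH S.limitSet).toReal < t →
        ∃ s ≤ t, 0 ≤ s ∧ ∃ ν : Measure ℝ, S.IsConformal ν s := fun t ht => by
      have hlt : dimH S.limitSet < ENNReal.ofReal t := (ENNReal.lt_ofReal_iff_toReal_lt hfin).2 ht
      obtain ⟨s, hs0, hst, hg, hd⟩ := S.exists_critical hne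
        (ENNReal.toReal_nonneg.trans ht.le) (S.hasSubexpGrowth_of_dimH_lt hlt)
      exact ⟨s, hst, hs0, S.exists_isConformal hne hg hd⟩
    refine le_antisymm (le_csInf ?_ fun t ht => ?_) (le_of_forall_gt_imp_ge_of_dense fun t ht => ?_)
    · obtain ⟨s, -, hs⟩ := hcrit _ (lt_add_one _)
      exact ⟨s, hs⟩
    · obtain ⟨ht0, ν, hν⟩ := ht
      exact ENNReal.toReal_le_of_le_ofReal ht0 (hν.dimH_limitSet_le ht0)
    · obtain ⟨s, hst, hs⟩ := hcrit t ht
      exact (csInf_le hbdd hs).trans hst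
  · have hΛ : S.limitSet = ∅ := eq_empty_of_forall_notMem fun x ⟨ω, hω, _⟩ => hne ⟨ω, hω⟩
    have hE : {t : ℝ | 0 ≤ t ∧ ∃ ν : Measure ℝ, S.IsConformal ν t} = ∅ :=
      eq_empty_of_forall_notMem fun t ⟨_, ν, hν, h0, _⟩ => by
        rw [hΛ, compl_empty, measure_univ] at h0
        exact one_ne_zero h0
    rw [hΛ, dimH_empty, ExpansiveMarkovSystem.tc, hE, Real.sInf_empty, ENNReal.ofReal_zero]
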